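/- arXiv:1703.00416 — 2 statements merged into one kernel-verified Lean document; each statement's English description precedes it below -/
import Mathlib

section
/- For every integer d ≥ 1, let m(n) denote the infimum over all n-tuples (x₁,…,x_n) of points on the unit sphere S^{2d+1} ⊂ ℝ^{2d+2} of the Riesz 2-energy Σ_{i≠j} ‖x_i − x_j‖^{-2}. Then limsup_{n→∞} ( (d/(2d−1))·n² − m(n) ) / n^{1+2/(2d+1)} ≥ 3^{1−2/(2d+1)} · (2d−1)^{1−2/(2d+1)} · (2d+1) · Γ(d−1/2)^{2−2/(2d+1)} / ( 2^{4−2/(2d+1)} · (d!)^{2−4/(2d+1)} ). -/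
open Filter Metric

/-- The infimum of the Riesz 2-energy over all `n`-tuples of (distinct) points on the unit
sphere `S^{2d+1} ⊆ ℝ^{2d+2}`. -/
noncomputable def riesz2MinEnergy (d n : ℕ) : ℝ :=
  sInf {E : ℝ | ∃ x : Fin n → sphere (0 : EuclideanSpace ℝ (Fin (2 * d + 2))) 1,
    Function.Injective x ∧
    E = ∑ i, ∑ j, if i ≠ j then
      1 / ‖(x i : EuclideanSpace ℝ (Fin (2 * d + 2)))
            - (x j : EuclideanSpace ℝ (Fin (2 * d + 2)))‖ ^ 2 else 0}

section PartA
noncomputable def cc (m : ℕ) : ℝ := (Nat.centralBinom m : ℝ) / 4 ^ m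
noncomputable def aa (d L m : ℕ) : ℝ := cc m / (Nat.choose (m + L + d) d : ℝ)
noncomputable def TT (d L : ℕ) : ℝ :=
  2 * d / (2 * d - 1) * ∏ l ∈ Finset.range L, ((l : ℝ) + 1) / (l + d + 1 / 2)

lemma cc_zero : cc 0 = 1 := by simp [cc]

lemma cc_pos (m : ℕ) : 0 < cc m := by
  unfold cc; have := Nat.centralBinom_pos m; positivity

lemma cc_succ (m : ℕ) : cc (m + 1) * (m + 1) = cc m * (m + 1 / 2) := by
  have h := Nat.succ_mul_centralBinom_succ m
  have h' : ((m : ℝ) + 1) * (Nat.centralBinom (m + 1) : ℝ)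
      = 2 * (2 * m + 1) * (Nat.centralBinom m : ℝ) := by exact_mod_cast h
  unfold cc
  rw [pow_succ]
  field_simp
  linear_combination 2 * h'

lemma cc_sq_le (m : ℕ) : cc m ^ 2 * (2 * m + 1) ≤ 1 := by
  induction m with
  | zero => simp [cc_zero]
  | succ m ih =>
    have h : cc (m + 1) = cc m * (m + 1 / 2) / (m + 1) := by
      rw [← cc_succ]; field_simp
    rw [h]
    have h2 : (cc m * (m + 1 / 2) / (m + 1)) ^ 2 * (2 * ((m + 1 : ℕ) : ℝ) + 1)
        = (cc m ^ 2 * (2 * m + 1)) * ((2 * m + 1) * (2 * m + 3) / (4 * (m + 1) ^ 2)) := by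
      push_cast; field_simp; ring
    rw [h2]
    have h3 : ((2 * (m : ℝ) + 1) * (2 * m + 3) / (4 * (m + 1) ^ 2)) ≤ 1 := by
      rw [div_le_one (by positivity)]; nlinarith
    exact mul_le_one₀ ih (by positivity) h3

lemma cc_tendsto : Tendsto cc atTop (nhds 0) := by
  have h : ∀ m : ℕ, cc m ≤ Real.sqrt (1 / ((m : ℝ) + 1)) := by
    intro m
    apply Real.le_sqrt_of_sq_le
    rw [le_div_iff₀ (by positivity)]
    have := cc_sq_le m
    nlinarith [sq_nonneg (cc m), mul_nonneg (sq_nonneg (cc m)) (Nat.cast_nonneg (α := ℝ) m)]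
  have h2 : Tendsto (fun m : ℕ => Real.sqrt (1 / ((m : ℝ) + 1))) atTop (nhds 0) := by
    have := (tendsto_one_div_add_atTop_nhds_zero_nat (𝕜 := ℝ)).sqrt
    simpa using this
  exact squeeze_zero (fun m => (cc_pos m).le) h h2

lemma aa_pos (d L m : ℕ) : 0 < aa d L m := by
  unfold aa
  have := cc_pos m
  have h2 : 0 < (m + L + d).choose d := Nat.choose_pos (by omega)
  positivity

lemma choose_step (N d : ℕ) :
    ((N + 1 + d).choose d : ℝ) * (N + 1) = ((N + d).choose d : ℝ) * (N + d + 1) := by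
  have h := Nat.add_one_mul_choose_eq (N + d) N
  have e1 : (N + 1 + d).choose d = (N + d).succ.choose N.succ := by
    rw [← Nat.choose_symm_of_eq_add (a := N + 1) (b := d) (n := N + 1 + d) rfl]
    congr 1; omega
  have e2 : (N + d).choose d = (N + d).choose N := by
    rw [← Nat.choose_symm_of_eq_add (a := N) (b := d) rfl]
  rw [e1, e2]
  have h' : ((N + d + 1 : ℕ) : ℝ) * ((N + d).choose N : ℝ) = ((N + d).succ.choose N.succ : ℝ) * ((N + 1 : ℕ) : ℝ) := by
    exact_mod_cast h
  push_cast at h' ⊢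
  linarith

lemma aa_succ_m (d L m : ℕ) :
    aa d L (m + 1) * ((m + 1) * (m + L + d + 1)) = aa d L m * ((m + 1 / 2) * (m + L + 1)) := by
  unfold aa
  have h1 := cc_succ m
  have h2 := choose_step (m + L) d
  have e : m + 1 + L + d = m + L + 1 + d := by ring
  rw [e]
  have p1 : (0 : ℝ) < (m + L + d).choose d := by exact_mod_cast Nat.choose_pos (by omega)
  have p2 : (0 : ℝ) < (m + L + 1 + d).choose d := by exact_mod_cast Nat.choose_pos (by omega)
  push_cast at h2
  field_simp
  have h1' : cc (m + 1) * (m + 1) * 2 = cc m * (2 * m + 1) := by linarith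
  linear_combination ((m + L + d).choose d : ℝ) * (m + L + d + 1) * h1' - cc m * (2 * m + 1) * h2

lemma aa_succ_L (d L m : ℕ) :
    aa d (L + 1) m * (m + L + d + 1) = aa d L m * (m + L + 1) := by
  unfold aa
  have h2 := choose_step (m + L) d
  have e : m + (L + 1) + d = m + L + 1 + d := by ring
  rw [e]
  have p1 : (0 : ℝ) < (m + L + d).choose d := by exact_mod_cast Nat.choose_pos (by omega)
  have p2 : (0 : ℝ) < (m + L + 1 + d).choose d := by exact_mod_cast Nat.choose_pos (by omega)
  push_cast at h2
  field_simp
  linear_combination (-cc m) * h2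

lemma choose_ge (N d : ℕ) (hd : 1 ≤ d) : (N : ℝ) + 1 ≤ ((N + d).choose d : ℝ) := by
  have h : (N + 1) ≤ (N + d).choose d := by
    rw [Nat.choose_symm_add.symm]
    calc N + 1 = (N + 1).choose N := by simp
      _ ≤ (N + d).choose N := Nat.choose_le_choose _ (by omega)
  exact_mod_cast h

lemma mul_aa_le (d L m : ℕ) (hd : 1 ≤ d) : ((m : ℝ) + 1) * aa d L m ≤ cc m := by
  unfold aa
  have h := choose_ge (m + L) d hd
  have p1 : (0 : ℝ) < (m + L + d).choose d := by exact_mod_cast Nat.choose_pos (by omega)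
  rw [← mul_div_assoc, div_le_iff₀ p1, mul_comm]
  apply mul_le_mul_of_nonneg_left _ (cc_pos m).le
  push_cast at h
  have : (0 : ℝ) ≤ L := Nat.cast_nonneg _
  linarith

lemma mul_aa_tendsto (d L : ℕ) (hd : 1 ≤ d) :
    Tendsto (fun m : ℕ => ((m : ℝ)) * aa d L m) atTop (nhds 0) := by
  refine squeeze_zero (fun m => mul_nonneg (Nat.cast_nonneg _) (aa_pos d L m).le) (fun m => ?_) cc_tendsto
  have := mul_aa_le d L m hd
  have := aa_pos d L m
  nlinarith

lemma aa_partial (d K : ℕ) (hd : 1 ≤ d) :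
    ∑ m ∈ Finset.range K, aa d 0 m = 2 * d / (2 * d - 1) - (K + d) / (d - 1 / 2) * aa d 0 K := by
  have hd' : (1 : ℝ) ≤ d := by exact_mod_cast hd
  have hp : (0 : ℝ) < 2 * d - 1 := by linarith
  have hp2 : (0 : ℝ) < d - 1 / 2 := by linarith
  induction K with
  | zero =>
    have : aa d 0 0 = 1 := by simp [aa, cc_zero]
    rw [this]; simp
    have hp3 : (d : ℝ) - 2⁻¹ ≠ 0 := by linarith
    field_simp
    ring
  | succ K ih =>
    rw [Finset.sum_range_succ, ih]
    have h := aa_succ_m d 0 K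
    have h' : aa d 0 (K + 1) * (K + d + 1) = aa d 0 K * (K + 1 / 2) := by
      have : ((K : ℝ) + 1) ≠ 0 := by positivity
      apply mul_right_cancel₀ this
      push_cast at h; linear_combination h
    push_cast
    have : (d : ℝ) - 1 / 2 ≠ 0 := hp2.ne'
    have e : ((K : ℝ) + 1 + d) / (d - 1 / 2) * aa d 0 (K + 1) = (aa d 0 K * (K + 1 / 2)) / (d - 1 / 2) := by
      rw [← h']; ring
    rw [e]
    have e2 : aa d 0 K = aa d 0 K * (d - 1 / 2) / (d - 1 / 2) := (mul_div_cancel_right₀ _ this).symm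
    have e3 : ((K : ℝ) + d) / (d - 1 / 2) * aa d 0 K = aa d 0 K * (K + 1/2) / (d - 1/2) + aa d 0 K * (d - 1/2) / (d - 1/2) := by
      ring
    rw [e3]; linarith

lemma aa_hasSum_zero (d : ℕ) (hd : 1 ≤ d) : HasSum (aa d 0) (2 * d / (2 * d - 1)) := by
  rw [hasSum_iff_tendsto_nat_of_nonneg (fun m => (aa_pos d 0 m).le)]
  simp_rw [aa_partial d _ hd]
  have h1 := (mul_aa_tendsto d 0 hd).const_mul ((d - 1 / 2 : ℝ)⁻¹)
  have h2 : Tendsto (fun m : ℕ => (d / (d - 1 / 2) : ℝ) * aa d 0 m) atTop (nhds 0) := by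
    have : Tendsto (aa d 0) atTop (nhds 0) := by
      refine squeeze_zero (fun m => (aa_pos d 0 m).le) (fun m => ?_) cc_tendsto
      have h := mul_aa_le d 0 m hd
      have := aa_pos d 0 m
      have : (0 : ℝ) ≤ m := Nat.cast_nonneg _
      nlinarith
    simpa using this.const_mul (d / (d - 1 / 2) : ℝ)
  have h3 := (h1.add h2).const_sub (2 * d / (2 * d - 1) : ℝ)
  simp only [mul_zero, add_zero, sub_zero] at h3
  refine h3.congr (fun m => ?_)
  ring

lemma TT_succ (d L : ℕ) : TT d (L + 1) = TT d L * ((L + 1) / (L + d + 1 / 2)) := by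
  unfold TT; rw [Finset.prod_range_succ]; ring

lemma aa_hasSum (d L : ℕ) (hd : 1 ≤ d) : HasSum (aa d L) (TT d L) := by
  induction L with
  | zero => simpa [TT] using aa_hasSum_zero d hd
  | succ L ih =>
    have hs : Summable (aa d (L + 1)) := by
      refine Summable.of_nonneg_of_le (fun m => (aa_pos d _ m).le) (fun m => ?_) ih.summable
      have h := aa_succ_L d L m
      have p : (0 : ℝ) < m + L + d + 1 := by positivity
      refine le_of_mul_le_mul_right ?_ p
      rw [h]
      apply mul_le_mul_of_nonneg_left _ (aa_pos d L m).le
      have : (0 : ℝ) ≤ d := Nat.cast_nonneg _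
      linarith
    have hpart : ∀ K : ℕ, ∑ m ∈ Finset.range K,
        ((L + d + 1 / 2 : ℝ) * aa d (L + 1) m - (L + 1) * aa d L m) = - (K * aa d L K) := by
      intro K
      induction K with
      | zero => simp
      | succ K ihK =>
        rw [Finset.sum_range_succ, ihK]
        have h1 := aa_succ_L d L K
        have h2 := aa_succ_m d L K
        have p : (0 : ℝ) < K + L + d + 1 := by positivity
        apply mul_right_cancel₀ p.ne'
        push_cast
        linear_combination (L + d + 1 / 2 : ℝ) * h1 + h2
    have hsum : HasSum (fun m => (L + d + 1 / 2 : ℝ) * aa d (L + 1) m - (L + 1) * aa d L m)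
        ((L + d + 1 / 2 : ℝ) * (∑' m, aa d (L + 1) m) - (L + 1) * TT d L) :=
      (hs.hasSum.mul_left _).sub (ih.mul_left _)
    have hlim := hsum.tendsto_sum_nat
    simp_rw [hpart] at hlim
    have h0 := (mul_aa_tendsto d L hd).neg
    have heq := tendsto_nhds_unique hlim h0
    have : ∑' m, aa d (L + 1) m = TT d (L + 1) := by
      rw [TT_succ]
      have p : (0 : ℝ) < L + d + 1 / 2 := by positivity
      field_simp
      have : (L + d + 1 / 2 : ℝ) * (∑' m, aa d (L + 1) m) = (L + 1) * TT d L := by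
        simp only [neg_zero] at heq; linarith
      linarith
    rw [← this]; exact hs.hasSum

lemma TT_tendsto (d : ℕ) (hd : 1 ≤ d) :
    Tendsto (fun L : ℕ => TT d L * (L : ℝ) ^ ((d : ℝ) - 1 / 2)) atTop
      (nhds (d * Real.Gamma (d - 1 / 2))) := by
  have hd' : (1 : ℝ) ≤ d := by exact_mod_cast hd
  have h1 := Real.GammaSeq_tendsto_Gamma ((d : ℝ) + 1 / 2)
  have h2 : Tendsto (fun L : ℕ => 1 + ((d : ℝ) + 1 / 2) / L) atTop (nhds 1) := by
    have := (tendsto_const_div_atTop_nhds_zero_nat ((d : ℝ) + 1 / 2)).const_add 1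
    simpa using this
  have h3 := (h1.mul h2).const_mul (2 * d / (2 * d - 1) : ℝ)
  have e : (2 * d / (2 * d - 1) : ℝ) * (Real.Gamma ((d : ℝ) + 1 / 2) * 1) = d * Real.Gamma (d - 1 / 2) := by
    have : (d : ℝ) + 1 / 2 = (d - 1 / 2) + 1 := by ring
    rw [this, Real.Gamma_add_one (by linarith)]
    have : (2 * d - 1 : ℝ) ≠ 0 := by linarith
    field_simp
  rw [e] at h3
  refine h3.congr' ?_
  filter_upwards [eventually_gt_atTop 0] with L hL
  have hL' : (0 : ℝ) < L := by exact_mod_cast hL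
  unfold TT Real.GammaSeq
  rw [Finset.prod_range_succ, Finset.prod_div_distrib]
  have e1 : (L : ℝ) ^ ((d : ℝ) + 1 / 2) = (L : ℝ) ^ ((d : ℝ) - 1 / 2) * L := by
    rw [← Real.rpow_add_one hL'.ne']; congr 1; ring
  rw [e1]
  have e2 : ∏ x ∈ Finset.range L, ((x : ℝ) + 1) = (L.factorial : ℝ) := by
    rw [← Finset.prod_range_add_one_eq_factorial]; push_cast; rfl
  have e3 : ∏ x ∈ Finset.range L, ((x : ℝ) + d + 1 / 2) = ∏ j ∈ Finset.range L, ((d : ℝ) + 1 / 2 + j) :=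
    Finset.prod_congr rfl (fun _ _ => by ring)
  rw [e2, e3]
  have p : (0 : ℝ) < ∏ j ∈ Finset.range L, ((d : ℝ) + 1 / 2 + j) :=
    Finset.prod_pos (fun _ _ => by positivity)
  have : (2 * d - 1 : ℝ) ≠ 0 := by linarith
  have q : (d : ℝ) + 1 / 2 + L ≠ 0 := by positivity
  field_simp
  ring
end PartA

section PartB
open ComplexConjugate in
noncomputable def HH {d : ℕ} (p q : Fin (d + 1) → ℂ) : ℂ := ∑ j, p j * conj (q j)

def mon {d : ℕ} (α : Fin (d + 1) → ℕ) (z : Fin (d + 1) → ℂ) : ℂ := ∏ j, z j ^ α j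

def mI (d N : ℕ) : Finset (Fin (d + 1) → ℕ) := Finset.piAntidiag Finset.univ N

def mlt {d : ℕ} (α : Fin (d + 1) → ℕ) : ℕ := Nat.multinomial Finset.univ α

lemma mem_mI {d N : ℕ} {α : Fin (d + 1) → ℕ} : α ∈ mI d N ↔ ∑ j, α j = N := by
  simp [mI, Finset.mem_piAntidiag]

lemma card_mI (d N : ℕ) : (mI d N).card = (N + d).choose d := by
  have h := Finset.card_finsuppAntidiag_nat_eq_choose (s := (Finset.univ : Finset (Fin (d + 1)))) N
  have e : (mI d N).card = ((Finset.univ : Finset (Fin (d + 1))).finsuppAntidiag N).card := by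
    symm
    refine Finset.card_bij (fun (f : Fin (d + 1) →₀ ℕ) _ => (f : Fin (d + 1) → ℕ)) ?_ ?_ ?_
    · intro f hf
      simpa [mem_mI, Finset.mem_finsuppAntidiag] using hf
    · intro f _ g _ h
      exact DFunLike.coe_injective h
    · intro α hα
      refine ⟨Finsupp.equivFunOnFinite.symm α, ?_, by simp⟩
      simpa [mem_mI, Finset.mem_finsuppAntidiag] using hα
  rw [e, h]
  simp only [Finset.card_univ, Fintype.card_fin]
  have : d + 1 + N - 1 = N + d := by omega
  rw [this]
  exact Nat.choose_symm_of_eq_add rfl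

open ComplexConjugate in
lemma HH_pow {d : ℕ} (p q : Fin (d + 1) → ℂ) (a : ℕ) :
    HH p q ^ a = ∑ α ∈ mI d a, (mlt α : ℂ) * (mon α p * conj (mon α q)) := by
  unfold HH mI mlt mon
  rw [Finset.sum_pow_eq_sum_piAntidiag]
  refine Finset.sum_congr rfl (fun α _ => ?_)
  congr 1
  simp [mul_pow, Finset.prod_mul_distrib]

open ComplexConjugate in
lemma HH_conj {d : ℕ} (p q : Fin (d + 1) → ℂ) : conj (HH p q) = HH q p := by
  simp [HH, mul_comm]

open ComplexConjugate in
lemma HH_self {d : ℕ} (p : Fin (d + 1) → ℂ) : HH p p = ((∑ j, ‖p j‖ ^ 2 : ℝ) : ℂ) := by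
  simp [HH, Complex.mul_conj, Complex.normSq_eq_norm_sq]

open ComplexConjugate in
lemma pow_pow_sum {d : ℕ} (p q : Fin (d + 1) → ℂ) (a b : ℕ) :
    HH p q ^ a * conj (HH p q) ^ b = ∑ α ∈ mI d a, ∑ β ∈ mI d b,
      ((mlt α : ℂ) * (mlt β : ℂ)) * ((mon α p * conj (mon β p)) * conj (mon α q * conj (mon β q))) := by
  rw [HH_pow, ← map_pow, HH_pow, map_sum, Finset.sum_mul_sum]
  refine Finset.sum_congr rfl (fun α _ => Finset.sum_congr rfl (fun β _ => ?_))
  simp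
  ring

open ComplexConjugate in
noncomputable def PP {d n : ℕ} (x : Fin n → Fin (d + 1) → ℂ) (a b : ℕ) : ℝ :=
  ∑ α ∈ mI d a, ∑ β ∈ mI d b,
    (mlt α : ℝ) * (mlt β : ℝ) * ‖∑ i, mon α (x i) * conj (mon β (x i))‖ ^ 2

lemma PP_nonneg {d n : ℕ} (x : Fin n → Fin (d + 1) → ℂ) (a b : ℕ) : 0 ≤ PP x a b := by
  unfold PP; positivity

open ComplexConjugate in
lemma PP_eq {d n : ℕ} (x : Fin n → Fin (d + 1) → ℂ) (a b : ℕ) :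
    (∑ i, ∑ j, HH (x i) (x j) ^ a * conj (HH (x i) (x j)) ^ b) = (PP x a b : ℂ) := by
  simp_rw [pow_pow_sum]
  unfold PP
  push_cast
  have h : ∀ α β : Fin (d + 1) → ℕ, ((‖∑ i, mon α (x i) * conj (mon β (x i))‖ : ℂ)) ^ 2
      = ∑ i, ∑ j, (mon α (x i) * conj (mon β (x i))) * conj (mon α (x j) * conj (mon β (x j))) := by
    intro α β
    rw [← Complex.mul_conj', map_sum, Finset.sum_mul_sum]
  simp_rw [h, Finset.mul_sum]
  rw [Finset.sum_comm' (t' := Finset.univ) (s' := fun _ => Finset.univ) (by simp)]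
  simp_rw [Finset.sum_comm (s := (Finset.univ : Finset (Fin n))) (t := mI d _)]
  refine Finset.sum_congr rfl (fun α _ => Finset.sum_congr rfl (fun β _ => ?_))
  rw [Finset.sum_comm]

open ComplexConjugate in
lemma PP_diag {d n : ℕ} (x : Fin n → Fin (d + 1) → ℂ) (hx : ∀ i, ∑ j, ‖x i j‖ ^ 2 = 1) (k : ℕ) :
    (n : ℝ) ^ 2 / ((k + d).choose d : ℝ) ≤ PP x k k := by
  have p1 : (0 : ℝ) < (k + d).choose d := by exact_mod_cast Nat.choose_pos (by omega)
  have h1 : ∑ α ∈ mI d k, ((mlt α : ℝ) * ∑ i, ‖mon α (x i)‖ ^ 2) = n := by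
    have : ∀ i, ∑ α ∈ mI d k, (mlt α : ℝ) * ‖mon α (x i)‖ ^ 2 = 1 := by
      intro i
      have h := HH_pow (x i) (x i) k
      rw [HH_self, hx] at h
      simp_rw [Complex.mul_conj'] at h
      have h' : (1 : ℝ) ^ k = ∑ α ∈ mI d k, (mlt α : ℝ) * ‖mon α (x i)‖ ^ 2 := by
        exact_mod_cast h
      simpa using h'.symm
    simp_rw [Finset.mul_sum]
    rw [Finset.sum_comm]
    simp [this]
  rw [div_le_iff₀ p1, ← h1, mul_comm, ← card_mI]
  refine (sq_sum_le_card_mul_sum_sq).trans ?_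
  apply mul_le_mul_of_nonneg_left _ (Nat.cast_nonneg _)
  unfold PP
  refine Finset.sum_le_sum (fun α hα => ?_)
  refine le_trans (le_of_eq ?_) (Finset.single_le_sum (f := fun β => (mlt α : ℝ) * (mlt β : ℝ) * ‖∑ i, mon α (x i) * conj (mon β (x i))‖ ^ 2) (fun β _ => by positivity) hα)
  have : ‖∑ i, mon α (x i) * conj (mon α (x i))‖ = ∑ i, ‖mon α (x i)‖ ^ 2 := by
    simp_rw [Complex.mul_conj']
    have : (∑ i, ((‖mon α (x i)‖ : ℂ)) ^ 2) = ((∑ i, ‖mon α (x i)‖ ^ 2 : ℝ) : ℂ) := by push_cast; rfl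
    rw [this, Complex.norm_real, Real.norm_of_nonneg (by positivity)]
  simp only [this]
  ring

open ComplexConjugate in
lemma re_pow (z : ℂ) (m : ℕ) : ((z.re ^ m : ℝ) : ℂ) =
    ∑ a ∈ Finset.range (m + 1), ((m.choose a : ℝ) / 2 ^ m : ℝ) * (z ^ a * conj z ^ (m - a)) := by
  have h : (z.re : ℂ) = (z + conj z) / 2 := by
    rw [Complex.add_conj]; push_cast; ring
  push_cast
  rw [h, div_pow, add_pow, Finset.sum_div]
  refine Finset.sum_congr rfl (fun a _ => ?_)
  ring

lemma sum_re_pow {d n : ℕ} (x : Fin n → Fin (d + 1) → ℂ) (m : ℕ) :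
    ∑ i, ∑ j, (HH (x i) (x j)).re ^ m =
      ∑ a ∈ Finset.range (m + 1), ((m.choose a : ℝ) / 2 ^ m : ℝ) * PP x a (m - a) := by
  apply Complex.ofReal_injective
  push_cast [← PP_eq]
  have := fun i j => re_pow (HH (x i) (x j)) m
  push_cast at this
  simp_rw [this, Finset.mul_sum]
  simp_rw [Finset.sum_comm (s := (Finset.univ : Finset (Fin n))) (t := Finset.range _)]

lemma sum_re_pow_nonneg {d n : ℕ} (x : Fin n → Fin (d + 1) → ℂ) (m : ℕ) :
    0 ≤ ∑ i, ∑ j, (HH (x i) (x j)).re ^ m := by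
  rw [sum_re_pow]
  exact Finset.sum_nonneg (fun a _ => mul_nonneg (by positivity) (PP_nonneg _ _ _))

lemma sum_re_pow_even {d n : ℕ} (x : Fin n → Fin (d + 1) → ℂ) (hx : ∀ i, ∑ j, ‖x i j‖ ^ 2 = 1)
    (k : ℕ) : (n : ℝ) ^ 2 * aa d 0 k ≤ ∑ i, ∑ j, (HH (x i) (x j)).re ^ (2 * k) := by
  rw [sum_re_pow]
  have h := Finset.single_le_sum (f := fun a => (((2 * k).choose a : ℝ) / 2 ^ (2 * k) : ℝ) * PP x a (2 * k - a))
    (fun a _ => mul_nonneg (by positivity) (PP_nonneg _ _ _)) (Finset.mem_range.2 (show k < 2 * k + 1 by omega))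
  refine le_trans ?_ h
  have e : 2 * k - k = k := by omega
  simp only [e]
  have h2 := PP_diag x hx k
  have e2 : (n : ℝ) ^ 2 * aa d 0 k = (((2 * k).choose k : ℝ) / 2 ^ (2 * k)) * ((n : ℝ) ^ 2 / ((k + d).choose d : ℝ)) := by
    unfold aa cc Nat.centralBinom
    rw [pow_mul]; norm_num; ring
  rw [e2]
  exact mul_le_mul_of_nonneg_left h2 (by positivity)

lemma HH_re_abs_le {d : ℕ} (p q : Fin (d + 1) → ℂ) (hp : ∑ j, ‖p j‖ ^ 2 = 1) (hq : ∑ j, ‖q j‖ ^ 2 = 1) :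
    ∑ j, ‖p j - q j‖ ^ 2 = 2 - 2 * (HH p q).re := by
  have : ∀ j, ‖p j - q j‖ ^ 2 = ‖p j‖ ^ 2 + ‖q j‖ ^ 2 - 2 * (p j * (starRingEnd ℂ) (q j)).re := by
    intro j
    simp only [← Complex.normSq_eq_norm_sq]
    rw [Complex.normSq_sub]
  simp_rw [this]
  rw [Finset.sum_sub_distrib, Finset.sum_add_distrib, hp, hq, ← Finset.mul_sum, HH, Complex.re_sum]
  norm_num

lemma rgeom_le (t : ℝ) (ht : t < 1) (K : ℕ) : ∑ m ∈ Finset.range (2 * K), t ^ m ≤ 1 / (1 - t) := by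
  rw [geom_sum_eq ht.ne, pow_mul]
  have h : (t ^ (2 * K) - 1) / (t - 1) = (1 - t ^ (2 * K)) / (1 - t) := by
    rw [← neg_div_neg_eq]; congr 1 <;> ring
  rw [← pow_mul, h]
  have : 0 < 1 - t := by linarith
  apply div_le_div_of_nonneg_right _ this.le
  have : 0 ≤ t ^ (2 * K) := by rw [pow_mul]; positivity
  linarith

/-- lower bound for the energy -/
lemma energy_lower {d n : ℕ} (hd : 1 ≤ d) (x : Fin n → Fin (d + 1) → ℂ) (hx : ∀ i, ∑ j, ‖x i j‖ ^ 2 = 1)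
    (hinj : Function.Injective x) (K : ℕ) :
    (n : ℝ) ^ 2 * (d / (2 * d - 1) - (K + d) / (2 * d - 1) * aa d 0 K) - n * K ≤
      ∑ i, ∑ j, if i ≠ j then 1 / (∑ l, ‖x i l - x j l‖ ^ 2) else 0 := by
  have hd' : (1 : ℝ) ≤ d := by exact_mod_cast hd
  have h1 : ∀ i j, (1 / 2 : ℝ) * (∑ m ∈ Finset.range (2 * K), (HH (x i) (x j)).re ^ m) - (if i = j then (K : ℝ) else 0)
      ≤ if i ≠ j then 1 / (∑ l, ‖x i l - x j l‖ ^ 2) else 0 := by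
    intro i j
    by_cases hij : i = j
    · subst hij
      have : (HH (x i) (x i)).re = 1 := by rw [HH_self, hx]; simp
      rw [this]; simp
    · simp only [hij, if_false, ne_eq, not_false_eq_true, if_true, sub_zero]
      rw [HH_re_abs_le _ _ (hx i) (hx j)]
      have hpos : 0 < ∑ l, ‖x i l - x j l‖ ^ 2 := by
        obtain ⟨l, hl⟩ := Function.ne_iff.1 (fun h => hij (hinj h))
        refine Finset.sum_pos' (fun _ _ => by positivity) ⟨l, Finset.mem_univ _, ?_⟩
        have : 0 < ‖x i l - x j l‖ := norm_pos_iff.2 (sub_ne_zero.2 hl)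
        positivity
      rw [HH_re_abs_le _ _ (hx i) (hx j)] at hpos
      have := rgeom_le (HH (x i) (x j)).re (by linarith) K
      have e : 1 / (2 - 2 * (HH (x i) (x j)).re) = 1 / 2 * (1 / (1 - (HH (x i) (x j)).re)) := by
        rw [one_div_mul_one_div]; congr 1; ring
      rw [e]
      linarith
  refine le_trans ?_ (Finset.sum_le_sum (fun i _ => Finset.sum_le_sum (fun j _ => h1 i j)))
  simp_rw [Finset.sum_sub_distrib, ← Finset.mul_sum]
  have e1 : ∑ i : Fin n, ∑ j : Fin n, (if i = j then (K : ℝ) else 0) = n * K := by simp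
  rw [e1]
  have e2 : ∑ i, ∑ j, ∑ m ∈ Finset.range (2 * K), (HH (x i) (x j)).re ^ m
     = ∑ m ∈ Finset.range (2 * K), ∑ i, ∑ j, (HH (x i) (x j)).re ^ m := by
    simp_rw [Finset.sum_comm (s := (Finset.univ : Finset (Fin n))) (t := Finset.range _)]
  rw [e2]
  have e3 : ∀ K : ℕ, (n : ℝ) ^ 2 * ∑ m ∈ Finset.range K, aa d 0 m ≤
      ∑ m ∈ Finset.range (2 * K), ∑ i, ∑ j, (HH (x i) (x j)).re ^ m := by
    intro K
    induction K with
    | zero => simp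
    | succ K ih =>
      rw [Finset.sum_range_succ, show 2 * (K + 1) = 2 * K + 1 + 1 by ring, Finset.sum_range_succ,
        Finset.sum_range_succ]
      have := sum_re_pow_even x hx K
      have := sum_re_pow_nonneg x (2 * K + 1)
      linarith
  have h4 := e3 K
  rw [aa_partial d K hd] at h4
  have e5 : (n : ℝ) ^ 2 * (d / (2 * d - 1) - (K + d) / (2 * d - 1) * aa d 0 K)
     = 1 / 2 * ((n : ℝ) ^ 2 * (2 * d / (2 * d - 1) - (K + d) / (d - 1 / 2) * aa d 0 K)) := by
    have : (d : ℝ) - 1 / 2 = (2 * d - 1) / 2 := by ring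
    rw [this]
    have : (2 * d - 1 : ℝ) ≠ 0 := by linarith
    field_simp
  rw [e5]
  linarith
end PartB

section PartC
open MeasureTheory ComplexConjugate unitInterval

def SC (d : ℕ) : Set (Fin (d + 1) → ℂ) := {z | ∑ j, ‖z j‖ ^ 2 = 1}

instance SC_compact (d : ℕ) : CompactSpace (SC d) := by
  rw [← isCompact_iff_compactSpace]
  apply Metric.isCompact_of_isClosed_isBounded
  · exact isClosed_eq (by fun_prop) continuous_const
  · rw [isBounded_iff_forall_norm_le]
    refine ⟨1, fun z hz => ?_⟩
    rw [pi_norm_le_iff_of_nonneg zero_le_one]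
    intro j
    have h : ‖z j‖ ^ 2 ≤ 1 := by
      rw [← (show ∑ j, ‖z j‖ ^ 2 = 1 from hz)]
      exact Finset.single_le_sum (f := fun j => ‖z j‖ ^ 2) (fun _ _ => by positivity) (Finset.mem_univ j)
    exact (sq_le_one_iff₀ (norm_nonneg _)).1 h

lemma beta_nat (A a : ℕ) : ∫ t in (0 : ℝ)..1, t ^ A * (1 - t) ^ a
    = (A.factorial * a.factorial : ℝ) / (A + a + 1).factorial := by
  induction a generalizing A with
  | zero =>
    simp [integral_pow, Nat.factorial_succ]
    field_simp
  | succ a ih =>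
    have h : ∀ t : ℝ, t ^ A * (1 - t) ^ (a + 1) = t ^ A * (1 - t) ^ a - t ^ (A + 1) * (1 - t) ^ a := by
      intro t; ring
    simp_rw [h]
    rw [intervalIntegral.integral_sub (Continuous.intervalIntegrable (by fun_prop) _ _)
      (Continuous.intervalIntegrable (by fun_prop) _ _), ih, ih]
    rw [show A + (a + 1) + 1 = A + a + 1 + 1 by ring, show A + 1 + a + 1 = A + a + 1 + 1 by ring,
      Nat.factorial_succ (A + a + 1), Nat.factorial_succ a, Nat.factorial_succ A]
    push_cast
    field_simp
    ring

lemma integral_I {f : ℝ → ℂ} : ∫ t : I, f t = ∫ t in (0 : ℝ)..1, f t := by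
  rw [intervalIntegral.integral_of_le zero_le_one, ← integral_Icc_eq_integral_Ioc]
  exact integral_subtype_comap measurableSet_Icc f

noncomputable def ee (θ : ℝ) : ℂ := Complex.exp (2 * Real.pi * θ * Complex.I)

lemma ee_norm (θ : ℝ) : ‖ee θ‖ = 1 := by
  unfold ee
  rw [show (2 * Real.pi * θ * Complex.I : ℂ) = ((2 * Real.pi * θ : ℝ) : ℂ) * Complex.I by push_cast; ring]
  exact Complex.norm_exp_ofReal_mul_I _

lemma ee_cont : Continuous ee := by unfold ee; fun_prop

lemma ee_orth (a b : ℕ) : ∫ θ : I, ee θ ^ a * conj (ee θ ^ b) = if a = b then 1 else 0 := by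
  rw [integral_I (f := fun θ => ee θ ^ a * conj (ee θ ^ b))]
  split_ifs with h
  · subst h
    have : ∀ θ : ℝ, ee θ ^ a * conj (ee θ ^ a) = 1 := by
      intro θ; rw [Complex.mul_conj, Complex.normSq_eq_norm_sq, norm_pow, ee_norm]; simp
    simp_rw [this]; simp
  · have hc : (2 * Real.pi * Complex.I * ((a : ℂ) - b)) ≠ 0 := by
      have : ((a : ℂ) - b) ≠ 0 := sub_ne_zero.2 (by exact_mod_cast h)
      have := Real.pi_ne_zero
      simp [*]
    have : ∀ θ : ℝ, ee θ ^ a * conj (ee θ ^ b) = Complex.exp ((2 * Real.pi * Complex.I * ((a : ℂ) - b)) * θ) := by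
      intro θ
      unfold ee
      rw [map_pow, ← Complex.exp_conj, ← Complex.exp_nat_mul, ← Complex.exp_nat_mul, ← Complex.exp_add]
      congr 1
      simp [Complex.conj_ofNat]
      ring
    simp_rw [this]
    rw [integral_exp_mul_complex hc]
    have e : (2 * Real.pi * Complex.I * ((a : ℂ) - b)) * ((1 : ℝ) : ℂ) = ((a : ℤ) - (b : ℤ) : ℤ) * (2 * Real.pi * Complex.I) := by
      push_cast; ring
    rw [e, Complex.exp_int_mul_two_pi_mul_I]
    simp

noncomputable def densI (d : ℕ) (t : I) : NNReal := Real.toNNReal ((d + 1) * (t : ℝ) ^ d)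

lemma densI_cont (d : ℕ) : Continuous (densI d) := by
  unfold densI; fun_prop

noncomputable def nuI (d : ℕ) : Measure I :=
  volume.withDensity (fun t : I => (densI d t : ENNReal))

instance nuI_fin (d : ℕ) : IsFiniteMeasure (nuI d) := by
  apply isFiniteMeasure_withDensity
  obtain ⟨C, hC⟩ := (isCompact_range (densI_cont d)).bddAbove
  refine ne_of_lt (lt_of_le_of_lt (lintegral_mono (g := fun _ => (C : ENNReal)) (fun t => ?_)) ?_)
  · exact ENNReal.coe_le_coe.2 (hC (Set.mem_range_self t))
  · simp

lemma nuI_int (d A a : ℕ) : ∫ t : I, (((t : ℝ) ^ A * (1 - (t : ℝ)) ^ a : ℝ) : ℂ) ∂(nuI d)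
    = (((d + 1) * ((A + d).factorial * a.factorial : ℝ) / (A + d + a + 1).factorial : ℝ) : ℂ) := by
  unfold nuI
  rw [integral_withDensity_eq_integral_smul (densI_cont d).measurable]
  have e : ∀ t : I, (densI d t • (((t : ℝ) ^ A * (1 - (t : ℝ)) ^ a : ℝ) : ℂ))
      = (fun s : ℝ => (((d + 1) * (s ^ (A + d) * (1 - s) ^ a) : ℝ) : ℂ)) t := by
    intro t
    have h0 : (0 : ℝ) ≤ t := t.2.1
    rw [NNReal.smul_def, densI, Real.coe_toNNReal _ (by positivity), Complex.real_smul, ← Complex.ofReal_mul]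
    congr 1
    ring
  simp_rw [e]
  rw [integral_I (f := (fun s : ℝ => (((d + 1) * (s ^ (A + d) * (1 - s) ^ a) : ℝ) : ℂ)))]
  rw [intervalIntegral.integral_ofReal, intervalIntegral.integral_const_mul, beta_nat]
  congr 1
  ring

def zz {d : ℕ} (z : SC d) : Fin (d + 1) → ℂ := z.1

lemma zz_cont {d : ℕ} : Continuous (zz (d := d)) := continuous_subtype_val

@[fun_prop]
lemma zz_cont' {d : ℕ} (j : Fin (d + 1)) : Continuous (fun z : SC d => zz z j) :=
  (continuous_apply j).comp continuous_subtype_val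

@[fun_prop]
lemma mon_cont {d : ℕ} (α : Fin (d + 1) → ℕ) : Continuous (fun z : SC d => mon α (zz z)) := by
  unfold mon; fun_prop

noncomputable def stepZ (d : ℕ) (w : I × I × SC d) : SC (d + 1) :=
  ⟨Fin.cons ((Real.sqrt (1 - w.1) : ℂ) * ee w.2.1) (fun j => (Real.sqrt w.1 : ℂ) * zz w.2.2 j), by
    have h1 : (0 : ℝ) ≤ 1 - w.1 := by have := w.1.2.2; linarith
    have h2 : (0 : ℝ) ≤ w.1 := w.1.2.1
    have h3 : ∑ j, ‖zz w.2.2 j‖ ^ 2 = 1 := w.2.2.2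
    simp only [SC, Set.mem_ofPred_eq]
    rw [Fin.sum_univ_succ]
    simp [ee_norm, mul_pow, Real.sq_sqrt h1, Real.sq_sqrt h2, ← Finset.mul_sum, h3]⟩

lemma stepZ_cont (d : ℕ) : Continuous (stepZ d) := by
  apply Continuous.subtype_mk
  apply continuous_pi
  intro j
  refine Fin.cases ?_ (fun j => ?_) j
  · simp only [Fin.cons_zero]
    have := ee_cont
    fun_prop
  · simp only [Fin.cons_succ]
    fun_prop

lemma mon_step (d : ℕ) (α : Fin (d + 2) → ℕ) (w : I × I × SC d) :
    mon α (zz (stepZ d w)) = ((Real.sqrt (1 - w.1) : ℂ) ^ α 0 * (Real.sqrt w.1 : ℂ) ^ (∑ j : Fin (d + 1), α j.succ)) *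
      (ee w.2.1 ^ α 0 * mon (fun j : Fin (d + 1) => α j.succ) (zz w.2.2)) := by
  unfold mon
  rw [Fin.prod_univ_succ]
  have h1 : zz (stepZ d w) 0 = (Real.sqrt (1 - w.1) : ℂ) * ee w.2.1 := rfl
  have h2 : ∀ j : Fin (d + 1), zz (stepZ d w) j.succ = (Real.sqrt w.1 : ℂ) * zz w.2.2 j := fun j => rfl
  simp_rw [h1, h2, mul_pow, Finset.prod_mul_distrib, Finset.prod_pow_eq_pow_sum]
  ring

theorem exists_measure (d : ℕ) : ∃ μ : Measure (SC d), IsProbabilityMeasure μ ∧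
    ∀ α β : Fin (d + 1) → ℕ, ∫ z, mon α (zz z) * conj (mon β (zz z)) ∂μ =
      if α = β then (((d.factorial * ∏ j, (α j).factorial : ℝ) / ((∑ j, α j) + d).factorial : ℝ) : ℂ) else 0 := by
  have key : ∃ μ : Measure (SC d), IsFiniteMeasure μ ∧
    ∀ α β : Fin (d + 1) → ℕ, ∫ z, mon α (zz z) * conj (mon β (zz z)) ∂μ =
      if α = β then (((d.factorial * ∏ j, (α j).factorial : ℝ) / ((∑ j, α j) + d).factorial : ℝ) : ℂ) else 0 := by
    induction d with
    | zero =>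
      let Z : I → SC 0 := fun θ => ⟨fun _ => ee θ, by simp [SC, ee_norm]⟩
      have hZ : Continuous Z := by
        apply Continuous.subtype_mk
        have := ee_cont
        fun_prop
      refine ⟨Measure.map Z volume, inferInstance, fun α β => ?_⟩
      rw [integral_map hZ.aemeasurable (Continuous.aestronglyMeasurable (by fun_prop))]
      have e : ∀ (α : Fin 1 → ℕ) (θ : I), mon α (zz (Z θ)) = ee θ ^ α 0 := by
        intro α θ; simp [mon, zz, Z]
      simp_rw [e]
      rw [ee_orth]
      by_cases h : α = β
      · subst h
        have : ((α 0).factorial : ℂ) ≠ 0 := by exact_mod_cast Nat.factorial_ne_zero _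
        simp [this]
      · have h' : α 0 ≠ β 0 := by
          intro h'; apply h; ext j; rw [show j = 0 from Fin.fin_one_eq_zero j, h']
        simp [h, h']
    | succ d ih =>
      obtain ⟨μ, hμ, hm⟩ := ih
      refine ⟨Measure.map (stepZ d) ((nuI d).prod ((volume : Measure I).prod μ)), inferInstance, fun α β => ?_⟩
      rw [integral_map (stepZ_cont d).aemeasurable (Continuous.aestronglyMeasurable (by fun_prop))]
      let f : I → ℂ := fun t => ((Real.sqrt (1 - t) : ℂ) ^ α 0 * (Real.sqrt t : ℂ) ^ (∑ j : Fin (d + 1), α j.succ)) *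
        ((Real.sqrt (1 - t) : ℂ) ^ β 0 * (Real.sqrt t : ℂ) ^ (∑ j : Fin (d + 1), β j.succ))
      let g : I → ℂ := fun θ => ee θ ^ α 0 * conj (ee θ ^ β 0)
      let h : SC d → ℂ := fun z => mon (fun j : Fin (d + 1) => α j.succ) (zz z) * conj (mon (fun j : Fin (d + 1) => β j.succ) (zz z))
      have e : ∀ w : I × I × SC d, mon α (zz (stepZ d w)) * conj (mon β (zz (stepZ d w))) = f w.1 * (g w.2.1 * h w.2.2) := by
        intro w
        rw [mon_step, mon_step]
        simp only [map_mul, map_pow, Complex.conj_ofReal, f, g, h]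
        ring
      simp_rw [e]
      rw [integral_prod_mul f (fun v : I × SC d => g v.1 * h v.2), integral_prod_mul g h, ee_orth, hm]
      by_cases hαβ : α = β
      · subst hαβ
        have hf : ∀ t : I, f t = (((t : ℝ) ^ (∑ j : Fin (d + 1), α j.succ) * (1 - (t : ℝ)) ^ (α 0) : ℝ) : ℂ) := by
          intro t
          have h1 : (0 : ℝ) ≤ 1 - t := by have := t.2.2; linarith
          have h2 : (0 : ℝ) ≤ t := t.2.1
          have ha : (Real.sqrt (1 - t) : ℂ) ^ 2 = 1 - ((t : ℝ) : ℂ) := by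
            exact_mod_cast Real.sq_sqrt h1
          have hb : (Real.sqrt t : ℂ) ^ 2 = ((t : ℝ) : ℂ) := by
            exact_mod_cast Real.sq_sqrt h2
          simp only [f]
          push_cast
          rw [← ha, ← hb]
          ring
        simp_rw [hf, nuI_int]
        simp only [if_true, one_mul]
        norm_cast
        rw [Fin.sum_univ_succ (f := α), Fin.prod_univ_succ (f := fun j => (α j).factorial)]
        rw [Nat.factorial_succ d, show α 0 + ∑ i : Fin (d + 1), α i.succ + (d + 1) = ∑ i : Fin (d + 1), α i.succ + d + α 0 + 1 by ring]
        push_cast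
        field_simp
      · rw [if_neg hαβ]
        by_cases h0 : α 0 = β 0
        · rw [if_neg (c := (fun j : Fin (d + 1) => α j.succ) = _)]
          · simp
          · intro hs
            apply hαβ
            ext j
            refine Fin.cases h0 (fun j => congrFun hs j) j
        · simp [h0]
  obtain ⟨μ, hμ, hm⟩ := key
  refine ⟨μ, ⟨?_⟩, hm⟩
  have h := hm 0 0
  simp [mon] at h
  have hd : (d.factorial : ℂ) ≠ 0 := by exact_mod_cast Nat.factorial_ne_zero _
  rw [div_self hd] at h
  have h' : μ.real Set.univ = 1 := by exact_mod_cast h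
  rw [measureReal_def, ENNReal.toReal_eq_one_iff] at h'
  exact h'
end PartC

section PartD
open MeasureTheory ComplexConjugate

lemma cint {X : Type*} [TopologicalSpace X] [CompactSpace X] [MeasurableSpace X] [OpensMeasurableSpace X]
    {μ : Measure X} [IsFiniteMeasure μ] {f : X → ℂ} (hf : Continuous f) : Integrable f μ :=
  hf.integrable_of_hasCompactSupport (HasCompactSupport.of_compactSpace f)

section
variable {d : ℕ} {ι : Type} [Fintype ι] [DecidableEq ι]

noncomputable def DD (φ : ι → SC d → ℂ) (x : ι → SC d) : ℂ := (Matrix.of fun a l => φ a (x l)).det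

lemma DD_cont (φ : ι → SC d → ℂ) (hφ : ∀ a, Continuous (φ a)) : Continuous (DD φ) := by
  unfold DD
  apply Continuous.matrix_det
  refine continuous_matrix fun a l => ?_
  exact (hφ a).comp (continuous_apply l)

lemma DD_expand (φ : ι → SC d → ℂ) (x : ι → SC d) (i j : ι) (hij : i ≠ j) (u v : SC d → ℂ) :
    DD φ x * conj (DD φ x) * (u (x i) * v (x j)) =
     ∑ σ : Equiv.Perm ι, ∑ τ : Equiv.Perm ι, ((Equiv.Perm.sign σ : ℤ) : ℂ) * ((Equiv.Perm.sign τ : ℤ) : ℂ) *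
       ∏ l, (φ (σ l) (x l) * conj (φ (τ l) (x l)) * (if l = i then u (x l) else if l = j then v (x l) else 1)) := by
  have h : u (x i) * v (x j) = ∏ l, (if l = i then u (x l) else if l = j then v (x l) else 1) := by
    rw [Fintype.prod_eq_mul i j hij]
    · simp [hij.symm]
    · rintro l ⟨h1, h2⟩; simp [h1, h2]
  rw [h]
  unfold DD
  rw [Matrix.det_apply', map_sum, Finset.sum_mul_sum, Finset.sum_mul]
  refine Finset.sum_congr rfl fun σ _ => ?_
  rw [Finset.sum_mul]
  refine Finset.sum_congr rfl fun τ _ => ?_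
  rw [Finset.prod_mul_distrib, Finset.prod_mul_distrib, map_mul, map_prod]
  simp only [Matrix.of_apply, map_intCast]
  ring

variable (μ : Measure (SC d)) [IsProbabilityMeasure μ]

lemma det_int (φ : ι → SC d → ℂ) (hφ : ∀ a, Continuous (φ a))
    (ho : ∀ a b, ∫ z, φ a z * conj (φ b z) ∂μ = if a = b then 1 else 0)
    (i j : ι) (hij : i ≠ j) (u v : SC d → ℂ) (hu : Continuous u) (hv : Continuous v) :
    ∫ x, DD φ x * conj (DD φ x) * (u (x i) * v (x j)) ∂(Measure.pi fun _ => μ) =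
      ∑ σ : Equiv.Perm ι, ((∫ z, φ (σ i) z * conj (φ (σ i) z) * u z ∂μ) * (∫ z, φ (σ j) z * conj (φ (σ j) z) * v z ∂μ)
        - (∫ z, φ (σ i) z * conj (φ (σ j) z) * u z ∂μ) * (∫ z, φ (σ j) z * conj (φ (σ i) z) * v z ∂μ)) := by
  simp_rw [DD_expand φ _ i j hij u v]
  have hc : ∀ (σ τ : Equiv.Perm ι), Continuous fun x : ι → SC d =>
      ((Equiv.Perm.sign σ : ℤ) : ℂ) * ((Equiv.Perm.sign τ : ℤ) : ℂ) *
       ∏ l, (φ (σ l) (x l) * conj (φ (τ l) (x l)) * (if l = i then u (x l) else if l = j then v (x l) else 1)) := by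
    intro σ τ
    refine continuous_const.mul (continuous_finsetProd _ fun l _ => ?_)
    refine Continuous.mul (by fun_prop) ?_
    split_ifs <;> fun_prop
  rw [integral_finsetSum _ (fun σ _ => cint (continuous_finsetSum _ fun τ _ => hc σ τ))]
  refine Finset.sum_congr rfl fun σ _ => ?_
  rw [integral_finsetSum _ (fun τ _ => cint (hc σ τ))]
  simp_rw [integral_const_mul]
  have hp : ∀ τ : Equiv.Perm ι, ∫ x, ∏ l, (φ (σ l) (x l) * conj (φ (τ l) (x l)) * (if l = i then u (x l) else if l = j then v (x l) else 1)) ∂(Measure.pi fun _ : ι => μ)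
     = ∏ l, ∫ z, φ (σ l) z * conj (φ (τ l) z) * (if l = i then u z else if l = j then v z else 1) ∂μ := by
    intro τ
    exact integral_fintype_prod_eq_prod (𝕜 := ℂ) (μ := fun _ : ι => μ) (fun l z => φ (σ l) z * conj (φ (τ l) z) * (if l = i then u z else if l = j then v z else 1))
  simp_rw [hp]
  rw [Finset.sum_eq_add (σ) (σ * Equiv.swap i j)]
  · have s1 : ((Equiv.Perm.sign σ : ℤ) : ℂ) * ((Equiv.Perm.sign σ : ℤ) : ℂ) = 1 := by
      rcases Int.units_eq_one_or (Equiv.Perm.sign σ) with h | h <;> simp [h]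
    have s2 : ((Equiv.Perm.sign (σ * Equiv.swap i j) : ℤ) : ℂ) = - ((Equiv.Perm.sign σ : ℤ) : ℂ) := by
      rw [Equiv.Perm.sign_mul, Equiv.Perm.sign_swap hij]; simp
    rw [s2, mul_neg, s1, one_mul, neg_mul, one_mul, sub_eq_add_neg]
    congr 1
    · rw [Fintype.prod_eq_mul i j hij]
      · simp [hij.symm]
      · rintro l ⟨h1, h2⟩; simp [h1, h2, ho]
    · congr 1
      rw [Fintype.prod_eq_mul i j hij]
      · simp [hij.symm]
      · rintro l ⟨h1, h2⟩; simp [h1, h2, ho, Equiv.swap_apply_of_ne_of_ne]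
  · intro h
    have := Equiv.ext_iff.1 h i
    simp at this
    exact hij this
  · rintro τ - ⟨h1, h2⟩
    by_cases hl : ∃ l, l ≠ i ∧ l ≠ j ∧ σ l ≠ τ l
    · obtain ⟨l, hi, hj, hn⟩ := hl
      rw [Finset.prod_eq_zero (Finset.mem_univ l), mul_zero]
      simp [hi, hj, ho, hn]
    · exfalso
      push Not at hl
      by_cases hi : σ i = τ i
      · apply h1
        have hj : τ j = σ j := by
          by_contra hne
          have : τ (τ.symm (σ j)) = σ j := by simp
          have hk : τ.symm (σ j) = j := by
            by_contra hk
            by_cases hki : τ.symm (σ j) = i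
            · rw [hki, ← hi] at this; exact hij (σ.injective this)
            · have h3 := hl _ hki hk
              rw [this] at h3; exact hk (σ.injective h3)
          rw [hk] at this; exact hne this
        ext l
        by_cases e1 : l = i
        · rw [e1, hi]
        by_cases e2 : l = j
        · rw [e2, hj]
        rw [hl l e1 e2]
      · apply h2
        have key : ∀ a b, (a = i ∧ b = j ∨ a = j ∧ b = i) → σ i ≠ τ i → τ a = σ b := by
          intro a b hab hne
          set k := σ.symm (τ a) with hkdef
          have hk : σ k = τ a := by simp [hkdef]
          by_cases k1 : k = i
          · rcases hab with ⟨rfl, rfl⟩ | ⟨rfl, rfl⟩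
            · rw [k1] at hk; exact absurd hk hne
            · rw [← hk, k1]
          by_cases k2 : k = j
          · rcases hab with ⟨rfl, rfl⟩ | ⟨rfl, rfl⟩
            · rw [← hk, k2]
            · -- σ j = τ j, then σ i must be τ i
              exfalso
              rw [k2] at hk
              set m := τ.symm (σ b) with hm
              have hm' : τ m = σ b := by simp [hm]
              by_cases m1 : m = b
              · rw [m1] at hm'; exact hne hm'.symm
              by_cases m2 : m = a
              · rw [m2, ← hk] at hm'; exact hij (σ.injective hm').symm
              · rw [← hl m m1 m2] at hm'; exact m1 (σ.injective hm')
          · rw [hl k k1 k2] at hk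
            have := τ.injective hk
            rcases hab with ⟨rfl, rfl⟩ | ⟨rfl, rfl⟩
            · exact absurd this k1
            · exact absurd this k2
        ext l
        by_cases e1 : l = i
        · rw [e1]; simp [key i j (Or.inl ⟨rfl, rfl⟩) hi]
        by_cases e2 : l = j
        · rw [e2]; simp [key j i (Or.inr ⟨rfl, rfl⟩) hi]
        rw [← hl l e1 e2]; simp [Equiv.swap_apply_of_ne_of_ne e1 e2]
  · simp
  · simp

end
end PartD

section PartE
open MeasureTheory ComplexConjugate

section
variable {d : ℕ} {ι : Type} [Fintype ι] [DecidableEq ι]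
variable (μ : Measure (SC d)) [IsProbabilityMeasure μ]

lemma det_mass (φ : ι → SC d → ℂ) (hφ : ∀ a, Continuous (φ a))
    (ho : ∀ a b, ∫ z, φ a z * conj (φ b z) ∂μ = if a = b then 1 else 0) (hι : 2 ≤ Fintype.card ι) :
    ∫ x, DD φ x * conj (DD φ x) ∂(Measure.pi fun _ => μ) = (Fintype.card ι).factorial := by
  obtain ⟨i, j, hij⟩ := Fintype.one_lt_card_iff.1 (show 1 < Fintype.card ι by omega)
  have h := det_int μ φ hφ ho i j hij (fun _ => 1) (fun _ => 1) continuous_const continuous_const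
  simp only [mul_one] at h
  rw [h]
  simp [ho, hij, Fintype.card_perm]

noncomputable def KK (φ : ι → SC d → ℂ) (p q : SC d) : ℂ := ∑ a, φ a p * conj (φ a q)

lemma det_sum (φ : ι → SC d → ℂ) (hφ : ∀ a, Continuous (φ a))
    (ho : ∀ a b, ∫ z, φ a z * conj (φ b z) ∂μ = if a = b then 1 else 0)
    (u v : SC d → ℂ) (hu : Continuous u) (hv : Continuous v) :
    (∑ i, ∑ j, if i ≠ j then ∫ x, DD φ x * conj (DD φ x) * (u (x i) * v (x j)) ∂(Measure.pi fun _ => μ) else 0) =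
      (Fintype.card ι).factorial *
        ∫ w : SC d × SC d, (u w.1 * v w.2) * (KK φ w.1 w.1 * KK φ w.2 w.2 - KK φ w.1 w.2 * KK φ w.2 w.1) ∂(μ.prod μ) := by
  set U : ι → ι → ℂ := fun a b => ∫ z, φ a z * conj (φ b z) * u z ∂μ with hU
  set V : ι → ι → ℂ := fun a b => ∫ z, φ a z * conj (φ b z) * v z ∂μ with hV
  have h1 : ∀ i j, (if i ≠ j then ∫ x, DD φ x * conj (DD φ x) * (u (x i) * v (x j)) ∂(Measure.pi fun _ => μ) else 0)
      = ∑ σ : Equiv.Perm ι, (U (σ i) (σ i) * V (σ j) (σ j) - U (σ i) (σ j) * V (σ j) (σ i)) := by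
    intro i j
    split_ifs with h
    · rw [det_int μ φ hφ ho i j h u v hu hv]
    · push Not at h; subst h; simp
  simp_rw [h1]
  have h2 : ∑ i, ∑ j, ∑ σ : Equiv.Perm ι, (U (σ i) (σ i) * V (σ j) (σ j) - U (σ i) (σ j) * V (σ j) (σ i))
     = ∑ σ : Equiv.Perm ι, ∑ a, ∑ b, (U a a * V b b - U a b * V b a) := by
    simp_rw [Finset.sum_comm (t := (Finset.univ : Finset (Equiv.Perm ι)))]
    refine Finset.sum_congr rfl fun σ _ => ?_
    rw [Equiv.sum_comp σ (fun a => ∑ j, (U a a * V (σ j) (σ j) - U a (σ j) * V (σ j) a))]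
    refine Finset.sum_congr rfl fun a _ => ?_
    rw [Equiv.sum_comp σ (fun b => (U a a * V b b - U a b * V b a))]
  rw [h2, Finset.sum_const, Finset.card_univ, Fintype.card_perm, nsmul_eq_mul]
  congr 1
  have h3 : ∀ w : SC d × SC d, (u w.1 * v w.2) * (KK φ w.1 w.1 * KK φ w.2 w.2 - KK φ w.1 w.2 * KK φ w.2 w.1)
    = ∑ a, ∑ b, ((φ a w.1 * conj (φ a w.1) * u w.1) * (φ b w.2 * conj (φ b w.2) * v w.2)
       - (φ a w.1 * conj (φ b w.1) * u w.1) * (φ b w.2 * conj (φ a w.2) * v w.2)) := by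
    intro w
    unfold KK
    simp_rw [Finset.sum_sub_distrib, mul_sub]
    congr 1
    · rw [Finset.sum_mul_sum, Finset.mul_sum]
      refine Finset.sum_congr rfl fun a _ => ?_
      rw [Finset.mul_sum]
      refine Finset.sum_congr rfl fun b _ => ?_
      ring
    · rw [Finset.sum_mul_sum, Finset.mul_sum]
      refine Finset.sum_congr rfl fun a _ => ?_
      rw [Finset.mul_sum]
      refine Finset.sum_congr rfl fun b _ => ?_
      ring
  simp_rw [h3]
  rw [integral_finsetSum _ (fun a _ => cint (by fun_prop))]
  refine Finset.sum_congr rfl fun a _ => ?_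
  rw [integral_finsetSum _ (fun b _ => cint (by fun_prop))]
  refine Finset.sum_congr rfl fun b _ => ?_
  rw [integral_sub (cint (by fun_prop)) (cint (by fun_prop))]
  rw [integral_prod_mul (fun z => φ a z * conj (φ a z) * u z) (fun z => φ b z * conj (φ b z) * v z),
    integral_prod_mul (fun z => φ a z * conj (φ b z) * u z) (fun z => φ b z * conj (φ a z) * v z)]

end

/-- the moment property -/
def MomP (d : ℕ) (μ : Measure (SC d)) : Prop := ∀ α β : Fin (d + 1) → ℕ, ∫ z, mon α (zz z) * conj (mon β (zz z)) ∂μ =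
      if α = β then (((d.factorial * ∏ j, (α j).factorial : ℝ) / ((∑ j, α j) + d).factorial : ℝ) : ℂ) else 0

lemma mlt_pos {d : ℕ} (α : Fin (d + 1) → ℕ) : 0 < mlt α := Nat.multinomial_pos _ _

lemma MomP.eq {d : ℕ} {μ : Measure (SC d)} (h : MomP d μ) {N M : ℕ} (α β : Fin (d + 1) → ℕ) (hα : α ∈ mI d N)
   (hβ : β ∈ mI d M) : 
    ∫ z, mon α (zz z) * conj (mon β (zz z)) ∂μ = if α = β then (1 / (((N + d).choose d : ℝ) * mlt α : ℝ) : ℂ) else 0 := by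
  rw [h α β]
  split_ifs with hab
  · have hN : ∑ j, α j = N := by simpa [mI] using hα
    rw [hN]
    have h1 : (∏ j, (α j).factorial) * mlt α = N.factorial := by
      have := Nat.multinomial_spec Finset.univ α
      rwa [hN] at this
    have h2 := Nat.add_choose_mul_factorial_mul_factorial N d
    have h3 : ((N + d).choose d : ℝ) * N.factorial * d.factorial = (N + d).factorial := by
      rw [← h2]; push_cast; ring
    have h4 : (∏ j, ((α j).factorial : ℝ)) * mlt α = N.factorial := by exact_mod_cast h1
    have h5 : ((mlt α : ℕ) : ℝ) ≠ 0 := by exact_mod_cast (mlt_pos α).ne'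
    have h6 : ((N + d).choose d : ℝ) ≠ 0 := by exact_mod_cast (Nat.choose_pos (by omega)).ne'
    have h7 : ((N + d).factorial : ℝ) ≠ 0 := by exact_mod_cast Nat.factorial_ne_zero _
    rw [show (1 / (((N + d).choose d : ℝ) * mlt α : ℝ) : ℂ) = ((1 / (((N + d).choose d : ℝ) * mlt α : ℝ) : ℝ) : ℂ) by push_cast; rfl]
    congr 1
    rw [div_eq_div_iff h7 (by positivity), ← h3, ← h4]; push_cast; ring
  · rfl

@[fun_prop]
lemma mon_cont2 {d : ℕ} (α : Fin (d + 1) → ℕ) : Continuous (fun z : Fin (d + 1) → ℂ => mon α z) := by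
  unfold mon; fun_prop

@[fun_prop]
lemma zz_cont2 {d : ℕ} : Continuous (fun z : SC d => zz z) := continuous_subtype_val

lemma HH_cont {d : ℕ} : Continuous fun w : SC d × SC d => HH (zz w.1) (zz w.2) := by
  unfold HH; fun_prop

lemma I_ab {d : ℕ} {μ : Measure (SC d)} [IsProbabilityMeasure μ] (h : MomP d μ) (a b : ℕ) :
    ∫ w : SC d × SC d, HH (zz w.1) (zz w.2) ^ a * conj (HH (zz w.1) (zz w.2)) ^ b ∂(μ.prod μ)
     = if a = b then (1 / ((a + d).choose d : ℝ) : ℂ) else 0 := by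
  simp_rw [pow_pow_sum]
  rw [integral_finsetSum _ (fun a _ => cint (by fun_prop))]
  have : ∀ α ∈ mI d a, ∫ w : SC d × SC d, ∑ β ∈ mI d b, (mlt α * mlt β : ℂ) * ((mon α (zz w.1) * conj (mon β (zz w.1))) * conj (mon α (zz w.2) * conj (mon β (zz w.2)))) ∂(μ.prod μ)
    = ∑ β ∈ mI d b, if α = β then (1 / ((a + d).choose d : ℝ) ^ 2 : ℂ) else 0 := by
    intro α hα
    rw [integral_finsetSum _ (fun a _ => cint (by fun_prop))]
    refine Finset.sum_congr rfl fun β hβ => ?_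
    rw [integral_const_mul, integral_prod_mul (fun z => mon α (zz z) * conj (mon β (zz z))) (fun z => conj (mon α (zz z) * conj (mon β (zz z)))),
      integral_conj, h.eq α β hα hβ]
    split_ifs with hab
    · subst hab
      have h5 : ((mlt α : ℕ) : ℂ) ≠ 0 := by exact_mod_cast (mlt_pos α).ne'
      have h6 : ((a + d).choose d : ℂ) ≠ 0 := by exact_mod_cast (Nat.choose_pos (by omega)).ne'
      simp
      field_simp
    · simp
  rw [Finset.sum_congr rfl this]
  split_ifs with hab
  · subst hab
    have : ∀ α ∈ mI d a, (∑ β ∈ mI d a, if α = β then (1 / ((a + d).choose d : ℝ) ^ 2 : ℂ) else 0) = (1 / ((a + d).choose d : ℝ) ^ 2 : ℂ) := by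
      intro α hα
      rw [Finset.sum_ite_eq, if_pos hα]
    rw [Finset.sum_congr rfl this, Finset.sum_const, card_mI, nsmul_eq_mul]
    have h6 : ((a + d).choose d : ℂ) ≠ 0 := by exact_mod_cast (Nat.choose_pos (by omega)).ne'
    simp
    field_simp
  · refine Finset.sum_eq_zero fun α hα => Finset.sum_eq_zero fun β hβ => ?_
    rw [if_neg]
    rintro rfl
    rw [mem_mI] at hα hβ
    omega
end PartE

section PartF
open MeasureTheory ComplexConjugate

noncomputable def phi (d L : ℕ) (α : mI d L) (z : SC d) : ℂ :=
  (Real.sqrt ((L + d).choose d * mlt α.1) : ℝ) * mon α.1 (zz z)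

lemma phi_cont (d L : ℕ) (α : mI d L) : Continuous (phi d L α) := by unfold phi; fun_prop

lemma phi_orth (d L : ℕ) {μ : Measure (SC d)} (h : MomP d μ) (a b : mI d L) :
    ∫ z, phi d L a z * conj (phi d L b z) ∂μ = if a = b then 1 else 0 := by
  unfold phi
  simp only [map_mul, Complex.conj_ofReal]
  have e : ∀ z : SC d, ((Real.sqrt ((L + d).choose d * mlt a.1) : ℝ) : ℂ) * mon a.1 (zz z) * (((Real.sqrt ((L + d).choose d * mlt b.1) : ℝ) : ℂ) * conj (mon b.1 (zz z)))
     = (((Real.sqrt ((L + d).choose d * mlt a.1) : ℝ) : ℂ) * ((Real.sqrt ((L + d).choose d * mlt b.1) : ℝ) : ℂ)) * (mon a.1 (zz z) * conj (mon b.1 (zz z))) := by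
    intro z; ring
  simp_rw [e]
  rw [integral_const_mul, h.eq a.1 b.1 a.2 b.2]
  by_cases hab : a = b
  · subst hab
    simp only [if_true]
    have h5 : ((mlt a.1 : ℕ) : ℝ) ≠ 0 := by exact_mod_cast (mlt_pos a.1).ne'
    have h6 : ((L + d).choose d : ℝ) ≠ 0 := by exact_mod_cast (Nat.choose_pos (by omega)).ne'
    rw [← Complex.ofReal_mul, Real.mul_self_sqrt (by positivity)]
    push_cast
    rw [mul_one_div, div_self]
    exact_mod_cast mul_ne_zero h6 h5
  · rw [if_neg hab, if_neg (fun h => hab (Subtype.ext h)), mul_zero]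

lemma KK_phi (d L : ℕ) (p q : SC d) : KK (phi d L) p q = (L + d).choose d * HH (zz p) (zz q) ^ L := by
  rw [HH_pow, Finset.mul_sum, ← Finset.sum_coe_sort]
  unfold KK
  refine Finset.sum_congr rfl fun α _ => ?_
  unfold phi
  simp only [map_mul, Complex.conj_ofReal]
  have : ((Real.sqrt ((L + d).choose d * mlt α.1) : ℝ) : ℂ) * ((Real.sqrt ((L + d).choose d * mlt α.1) : ℝ) : ℂ) = ((L + d).choose d * mlt α.1 : ℂ) := by
    rw [← Complex.ofReal_mul, Real.mul_self_sqrt (by positivity)]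
    push_cast; rfl
  linear_combination (mon α.1 (zz p) * conj (mon α.1 (zz q))) * this

lemma HH_zz_self {d : ℕ} (p : SC d) : HH (zz p) (zz p) = 1 := by
  rw [HH_self]
  have : ∑ j, ‖zz p j‖ ^ 2 = 1 := p.2
  rw [this]; simp

lemma KK_phi_self (d L : ℕ) (p : SC d) : KK (phi d L) p p = (L + d).choose d := by
  rw [KK_phi, HH_zz_self]; simp

noncomputable def JJ (d L a : ℕ) : ℝ := ((L + d).choose d : ℝ) ^ 2 * (1 / ((a + d).choose d : ℝ) - 1 / ((a + L + d).choose d : ℝ))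

noncomputable abbrev piM {d : ℕ} (L : ℕ) (μ : Measure (SC d)) : Measure (mI d L → SC d) := Measure.pi fun _ => μ

lemma cont_ev {d : ℕ} {ι : Type} (i : ι) : Continuous fun x : ι → SC d => x i := continuous_apply i

lemma E_ab {d : ℕ} (L : ℕ) {μ : Measure (SC d)} [IsProbabilityMeasure μ] (h : MomP d μ) (a b : ℕ) :
    (∑ i : mI d L, ∑ j : mI d L, if i ≠ j then ∫ x, DD (phi d L) x * conj (DD (phi d L) x) *
      (HH (zz (x i)) (zz (x j)) ^ a * conj (HH (zz (x i)) (zz (x j))) ^ b) ∂(piM L μ) else 0) =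
    if a = b then ((((L + d).choose d).factorial : ℝ) * JJ d L a : ℂ) else 0 := by
  have hDc : Continuous (DD (phi d L)) := DD_cont _ (phi_cont d L)
  have hcard : Fintype.card (mI d L) = (L + d).choose d := by rw [Fintype.card_coe, card_mI]
  have e1 : ∀ i j : mI d L, (if i ≠ j then ∫ x, DD (phi d L) x * conj (DD (phi d L) x) *
      (HH (zz (x i)) (zz (x j)) ^ a * conj (HH (zz (x i)) (zz (x j))) ^ b) ∂(piM L μ) else 0)
     = ∑ α ∈ mI d a, ∑ β ∈ mI d b, (mlt α * mlt β : ℂ) * (if i ≠ j then ∫ x, DD (phi d L) x * conj (DD (phi d L) x) *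
       ((mon α (zz (x i)) * conj (mon β (zz (x i)))) * conj (mon α (zz (x j)) * conj (mon β (zz (x j))))) ∂(piM L μ) else 0) := by
    intro i j
    split_ifs with hij
    · simp_rw [pow_pow_sum, Finset.mul_sum]
      rw [integral_finsetSum _ (fun a _ => cint (by fun_prop))]
      refine Finset.sum_congr rfl fun α _ => ?_
      rw [integral_finsetSum _ (fun a _ => cint (by fun_prop))]
      refine Finset.sum_congr rfl fun β _ => ?_
      rw [← integral_const_mul]
      congr 1; ext x; ring
    · simp
  simp_rw [e1]
  have e2 : ∀ f : mI d L → mI d L → (Fin (d+1) → ℕ) → (Fin (d+1) → ℕ) → ℂ,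
      ∑ i, ∑ j, ∑ α ∈ mI d a, ∑ β ∈ mI d b, f i j α β = ∑ α ∈ mI d a, ∑ β ∈ mI d b, ∑ i, ∑ j, f i j α β := by
    intro f
    simp_rw [Finset.sum_comm (s := Finset.univ) (t := mI d a), Finset.sum_comm (s := Finset.univ) (t := mI d b)]
  rw [e2]
  simp_rw [← Finset.mul_sum]
  have e3 : ∀ α β, (∑ i : mI d L, ∑ j : mI d L, (if i ≠ j then ∫ x, DD (phi d L) x * conj (DD (phi d L) x) *
       ((mon α (zz (x i)) * conj (mon β (zz (x i)))) * conj (mon α (zz (x j)) * conj (mon β (zz (x j))))) ∂(piM L μ) else 0)) = _ :=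
    fun α β => det_sum μ (phi d L) (phi_cont d L) (phi_orth d L h) (fun z => mon α (zz z) * conj (mon β (zz z)))
      (fun z => conj (mon α (zz z) * conj (mon β (zz z)))) (by fun_prop) (by fun_prop)
  simp_rw [e3]
  rw [hcard]
  set R : ℂ := (((L + d).choose d : ℕ) : ℂ) with hR
  have hH : Continuous fun w : SC d × SC d => HH (zz w.1) (zz w.2) := HH_cont
  have e4 : ∑ α ∈ mI d a, ∑ β ∈ mI d b, (mlt α * mlt β : ℂ) * ((((L + d).choose d).factorial : ℂ) * 
      ∫ w : SC d × SC d, (mon α (zz w.1) * conj (mon β (zz w.1)) * conj (mon α (zz w.2) * conj (mon β (zz w.2)))) * (KK (phi d L) w.1 w.1 * KK (phi d L) w.2 w.2 - KK (phi d L) w.1 w.2 * KK (phi d L) w.2 w.1) ∂(μ.prod μ))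
      = (((L + d).choose d).factorial : ℂ) * ∫ w : SC d × SC d, R ^ 2 * (HH (zz w.1) (zz w.2) ^ a * conj (HH (zz w.1) (zz w.2)) ^ b) - R ^ 2 * (HH (zz w.1) (zz w.2) ^ (a + L) * conj (HH (zz w.1) (zz w.2)) ^ (b + L)) ∂(μ.prod μ) := by
    have e5 : ∀ w : SC d × SC d, R ^ 2 * (HH (zz w.1) (zz w.2) ^ a * conj (HH (zz w.1) (zz w.2)) ^ b) - R ^ 2 * (HH (zz w.1) (zz w.2) ^ (a + L) * conj (HH (zz w.1) (zz w.2)) ^ (b + L))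
       = ∑ α ∈ mI d a, ∑ β ∈ mI d b, (mlt α * mlt β : ℂ) * ((mon α (zz w.1) * conj (mon β (zz w.1)) * conj (mon α (zz w.2) * conj (mon β (zz w.2)))) * (R * R - R * HH (zz w.1) (zz w.2) ^ L * (R * conj (HH (zz w.1) (zz w.2)) ^ L))) := by
      intro w
      simp_rw [← mul_assoc _ _ (R * R - _), ← Finset.sum_mul]
      rw [← pow_pow_sum]; ring
    simp_rw [e5]
    rw [integral_finsetSum _ (fun a _ => cint (by fun_prop)), Finset.mul_sum]
    refine Finset.sum_congr rfl fun α _ => ?_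
    rw [integral_finsetSum _ (fun a _ => cint (by fun_prop)), Finset.mul_sum]
    refine Finset.sum_congr rfl fun β _ => ?_
    rw [integral_const_mul]
    simp_rw [KK_phi_self, KK_phi, HH_conj, ← hR]
    ring
  rw [e4]
  rw [integral_sub (cint (by fun_prop)) (cint (by fun_prop)), integral_const_mul, integral_const_mul, I_ab h, I_ab h]
  by_cases hab : a = b
  · subst hab
    simp only [if_true, JJ]
    push_cast
    ring
  · simp [hab]
end PartF

section PartG
open MeasureTheory ComplexConjugate

lemma HH_smul {d : ℕ} (ζ : ℂ) (p q : Fin (d + 1) → ℂ) : HH (fun j => ζ * p j) q = ζ * HH p q := by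
  unfold HH; rw [Finset.mul_sum]; refine Finset.sum_congr rfl fun j _ => by ring

lemma mon_smul {d : ℕ} (ζ : ℂ) (α : Fin (d + 1) → ℕ) (p : Fin (d + 1) → ℂ) :
    mon α (fun j => ζ * p j) = ζ ^ (∑ j, α j) * mon α p := by
  unfold mon; simp_rw [mul_pow]; rw [Finset.prod_mul_distrib, Finset.prod_pow_eq_pow_sum]

noncomputable def tt {d : ℕ} (ζ : ℂ) (p q : SC d) : ℝ := (ζ * HH (zz p) (zz q)).re

lemma tt_neg {d : ℕ} (ζ : ℂ) (p q : SC d) : tt (-ζ) p q = - tt ζ p q := by simp [tt]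

lemma tt_dist {d : ℕ} {ζ : ℂ} (hζ : ‖ζ‖ = 1) (p q : SC d) :
    ∑ j, ‖ζ * zz p j - zz q j‖ ^ 2 = 2 - 2 * tt ζ p q := by
  unfold tt
  rw [← HH_smul]
  refine HH_re_abs_le (fun j => ζ * zz p j) (zz q) ?_ q.2
  simp only [norm_mul, hζ, one_mul]
  exact p.2

lemma tt_le {d : ℕ} {ζ : ℂ} (hζ : ‖ζ‖ = 1) (p q : SC d) : tt ζ p q ≤ 1 := by
  have h := tt_dist hζ p q
  have : 0 ≤ ∑ j, ‖ζ * zz p j - zz q j‖ ^ 2 := Finset.sum_nonneg fun _ _ => by positivity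
  linarith

lemma tt_ge {d : ℕ} {ζ : ℂ} (hζ : ‖ζ‖ = 1) (p q : SC d) : -1 ≤ tt ζ p q := by
  have := tt_le (ζ := -ζ) (by simpa using hζ) p q
  rw [tt_neg] at this; linarith

lemma tt_eq_one {d : ℕ} {ζ : ℂ} (hζ : ‖ζ‖ = 1) (p q : SC d) (h : tt ζ p q = 1) (j) : zz q j = ζ * zz p j := by
  have h' := tt_dist hζ p q
  rw [h, show (2 : ℝ) - 2 * 1 = 0 by norm_num, Finset.sum_eq_zero_iff_of_nonneg (fun _ _ => by positivity)] at h'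
  have := h' j (Finset.mem_univ j)
  have := norm_eq_zero.1 (pow_eq_zero_iff (two_ne_zero) |>.1 this)
  exact (sub_eq_zero.1 this).symm

lemma DD_zero {d L : ℕ} (x : mI d L → SC d) (i j : mI d L) (hij : i ≠ j) (ζ : ℂ)
    (h : ∀ l, zz (x j) l = ζ * zz (x i) l) : DD (phi d L) x = 0 := by
  unfold DD
  rw [← Matrix.exists_mulVec_eq_zero_iff]
  refine ⟨Pi.single j 1 - Pi.single i (ζ ^ L), ?_, ?_⟩
  · intro h0
    have := congrFun h0 j
    simp [hij.symm] at this
  · rw [Matrix.mulVec_sub, Matrix.mulVec_single, Matrix.mulVec_single]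
    ext a
    have hz : zz (x j) = fun l => ζ * zz (x i) l := funext h
    have ha : ∑ l, a.1 l = L := (mem_mI).1 a.2
    simp [phi, hz, mon_smul, ha]
    ring

lemma tt_abs_lt {d L : ℕ} (x : mI d L → SC d) (hx : DD (phi d L) x ≠ 0) (i j : mI d L) (hij : i ≠ j) {ζ : ℂ}
    (hζ : ‖ζ‖ = 1) : |tt ζ (x i) (x j)| < 1 := by
  rw [abs_lt]
  constructor
  · refine lt_of_le_of_ne (tt_ge hζ _ _) fun h => hx ?_
    refine DD_zero x i j hij (-ζ) (tt_eq_one (by simpa using hζ) _ _ ?_)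
    rw [tt_neg, ← h]; simp
  · refine lt_of_le_of_ne (tt_le hζ _ _) fun h => hx ?_
    exact DD_zero x i j hij (ζ) (tt_eq_one hζ _ _ h)

lemma geom_t {t : ℝ} (h : |t| < 1) : HasSum (fun m : ℕ => (1 + t) * t ^ (2 * m)) (1 / (1 - t)) := by
  have h2 : t ^ 2 < 1 := (sq_lt_one_iff_abs_lt_one t).2 h
  have := (hasSum_geometric_of_lt_one (sq_nonneg t) h2).mul_left (1 + t)
  simp_rw [← pow_mul] at this
  rw [abs_lt] at h
  have h4 : 1 + t ≠ 0 := by linarith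
  have e : (1 + t) * (1 - t ^ 2)⁻¹ = 1 / (1 - t) := by
    rw [show 1 - t ^ 2 = (1 - t) * (1 + t) by ring, mul_inv, mul_comm (1 - t)⁻¹, ← mul_assoc, mul_inv_cancel₀ h4, one_mul, one_div]
  rw [e] at this
  exact this

lemma HH_cont' {d : ℕ} {X : Type*} [TopologicalSpace X] {f g : X → SC d} (hf : Continuous f) (hg : Continuous g) :
    Continuous fun x => HH (zz (f x)) (zz (g x)) := HH_cont.comp (hf.prodMk hg)

lemma tt_cont {d : ℕ} (ζ : ℂ) {X : Type*} [TopologicalSpace X] {f g : X → SC d} (hf : Continuous f) (hg : Continuous g) :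
    Continuous fun x => tt ζ (f x) (g x) := by
  unfold tt
  exact Complex.continuous_re.comp (continuous_const.mul (HH_cont' hf hg))

noncomputable def DR (d L : ℕ) (x : mI d L → SC d) : ℝ := Complex.normSq (DD (phi d L) x)

lemma DR_cont (d L : ℕ) : Continuous (DR d L) := Complex.continuous_normSq.comp (DD_cont _ (phi_cont d L))

lemma DR_eq (d L : ℕ) (x) : ((DR d L x : ℝ) : ℂ) = DD (phi d L) x * conj (DD (phi d L) x) := by
  rw [Complex.mul_conj]; rfl

lemma DR_mass {d L : ℕ} {μ : Measure (SC d)} [IsProbabilityMeasure μ] (h : MomP d μ) (hL : 2 ≤ (L + d).choose d) :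
    ∫ x, DR d L x ∂(piM L μ) = ((L + d).choose d).factorial := by
  have hcard : Fintype.card (mI d L) = (L + d).choose d := by rw [Fintype.card_coe, card_mI]
  have := det_mass μ (phi d L) (phi_cont d L) (phi_orth d L h) (by rw [hcard]; exact hL)
  simp_rw [← DR_eq] at this
  rw [integral_complex_ofReal, hcard] at this
  exact_mod_cast this

lemma E_t {d : ℕ} (L : ℕ) {μ : Measure (SC d)} [IsProbabilityMeasure μ] (h : MomP d μ) (ζ : ℂ) (m : ℕ) :
    ((∑ i : mI d L, ∑ j : mI d L, if i ≠ j then ∫ x, DR d L x * tt ζ (x i) (x j) ^ m ∂(piM L μ) else 0 : ℝ) : ℂ)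
     = ∑ a ∈ Finset.range (m + 1), (((m.choose a : ℝ) / 2 ^ m : ℝ) : ℂ) * (ζ ^ a * conj ζ ^ (m - a)) * 
        if a = m - a then ((((L + d).choose d).factorial : ℝ) * JJ d L a : ℂ) else 0 := by
  have hDc : Continuous (DD (phi d L)) := DD_cont _ (phi_cont d L)
  simp_rw [← E_ab L h]
  push_cast
  simp_rw [Finset.mul_sum]
  have e2 : ∀ f : mI d L → mI d L → ℕ → ℂ,
      ∑ a ∈ Finset.range (m + 1), ∑ i, ∑ j, f i j a = ∑ i, ∑ j, ∑ a ∈ Finset.range (m + 1), f i j a := by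
    intro f
    rw [Finset.sum_comm]
    refine Finset.sum_congr rfl fun i _ => ?_
    rw [Finset.sum_comm]
  rw [e2]
  refine Finset.sum_congr rfl fun i _ => Finset.sum_congr rfl fun j _ => ?_
  split_ifs with hij
  · rw [← integral_complex_ofReal]
    push_cast
    simp_rw [← integral_const_mul]
    rw [← integral_finsetSum _ (fun a _ => cint ?_)]
    · congr 1
      ext x
      rw [DR_eq]
      have := re_pow (ζ * HH (zz (x i)) (zz (x j))) m
      unfold tt
      push_cast at this
      rw [this, Finset.mul_sum]
      refine Finset.sum_congr rfl fun a _ => ?_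
      rw [map_mul, mul_pow, mul_pow]
      ring
    · have := HH_cont' (cont_ev (d := d) i) (cont_ev j)
      fun_prop
  · simp

lemma E_t_even {d : ℕ} (L : ℕ) {μ : Measure (SC d)} [IsProbabilityMeasure μ] (h : MomP d μ) (ζ : ℂ) (hζ : ‖ζ‖ = 1) (m : ℕ) :
    (∑ i : mI d L, ∑ j : mI d L, if i ≠ j then ∫ x, DR d L x * tt ζ (x i) (x j) ^ (2 * m) ∂(piM L μ) else 0)
     = ((L + d).choose d).factorial * (cc m * JJ d L m) := by
  rw [← Complex.ofReal_inj, E_t L h, Finset.sum_eq_single m]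
  · rw [if_pos (by omega), show 2 * m - m = m by omega, ← mul_pow, Complex.mul_conj, Complex.normSq_eq_norm_sq, hζ]
    unfold cc
    rw [pow_mul, Nat.centralBinom]
    norm_num
    ring
  · intro a _ ha
    rw [if_neg (by omega), mul_zero]
  · intro hm; simp at hm; omega

lemma E_t_odd {d : ℕ} (L : ℕ) {μ : Measure (SC d)} [IsProbabilityMeasure μ] (h : MomP d μ) (ζ : ℂ) (m : ℕ) :
    (∑ i : mI d L, ∑ j : mI d L, if i ≠ j then ∫ x, DR d L x * tt ζ (x i) (x j) ^ (2 * m + 1) ∂(piM L μ) else 0)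
     = 0 := by
  rw [← Complex.ofReal_inj, E_t L h, Finset.sum_eq_zero]
  · simp
  · intro a _
    rw [if_neg (by omega), mul_zero]

lemma rint {X : Type*} [TopologicalSpace X] [CompactSpace X] [MeasurableSpace X] [OpensMeasurableSpace X]
    {μ : Measure X} [IsFiniteMeasure μ] {f : X → ℝ} (hf : Continuous f) : Integrable f μ :=
  hf.integrable_of_hasCompactSupport (HasCompactSupport.of_compactSpace f)

lemma E_step {d : ℕ} (L : ℕ) {μ : Measure (SC d)} [IsProbabilityMeasure μ] (h : MomP d μ) {κ : Type} [Fintype κ]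
    (ζ : κ → ℂ) (hζ : ∀ k, ‖ζ k‖ = 1) (m : ℕ) :
    ∫ x, DR d L x * (∑ i : mI d L, ∑ j : mI d L, if i ≠ j then ∑ k, (1 + tt (ζ k) (x i) (x j)) * tt (ζ k) (x i) (x j) ^ (2 * m) else 0) ∂(piM L μ)
     = ((L + d).choose d).factorial * (Fintype.card κ * ((L + d).choose d : ℝ) ^ 2 * (aa d 0 m - aa d L m)) := by
  have hD := DR_cont d L
  have ht : ∀ k (i j : mI d L), Continuous fun x : mI d L → SC d => tt (ζ k) (x i) (x j) := fun k i j =>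
    tt_cont _ (cont_ev i) (cont_ev j)
  have e1 : ∀ x, DR d L x * (∑ i : mI d L, ∑ j : mI d L, if i ≠ j then ∑ k, (1 + tt (ζ k) (x i) (x j)) * tt (ζ k) (x i) (x j) ^ (2 * m) else 0)
    = ∑ i : mI d L, ∑ j : mI d L, ∑ k, if i ≠ j then DR d L x * tt (ζ k) (x i) (x j) ^ (2 * m) + DR d L x * tt (ζ k) (x i) (x j) ^ (2 * m + 1) else 0 := by
    intro x
    rw [Finset.mul_sum]; refine Finset.sum_congr rfl fun i _ => ?_
    rw [Finset.mul_sum]; refine Finset.sum_congr rfl fun j _ => ?_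
    split_ifs
    · rw [Finset.mul_sum]; refine Finset.sum_congr rfl fun k _ => ?_
      ring
    · simp
  have hc : ∀ (i j : mI d L) k, Continuous fun x : mI d L → SC d => if i ≠ j then DR d L x * tt (ζ k) (x i) (x j) ^ (2 * m) + DR d L x * tt (ζ k) (x i) (x j) ^ (2 * m + 1) else 0 := by
    intro i j k
    have := ht k i j
    split_ifs <;> fun_prop
  simp_rw [e1]
  rw [integral_finsetSum _ (fun i _ => rint (continuous_finsetSum _ fun j _ => continuous_finsetSum _ fun k _ => hc i j k))]
  simp_rw [integral_finsetSum (μ := piM L μ) Finset.univ (fun j _ => rint (continuous_finsetSum Finset.univ fun k _ => hc _ j k))]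
  simp_rw [integral_finsetSum (μ := piM L μ) Finset.univ (fun k _ => rint (hc _ _ k))]
  have e3 : ∀ (i j : mI d L) k, ∫ x, (if i ≠ j then DR d L x * tt (ζ k) (x i) (x j) ^ (2 * m) + DR d L x * tt (ζ k) (x i) (x j) ^ (2 * m + 1) else 0) ∂(piM L μ)
    = (if i ≠ j then ∫ x, DR d L x * tt (ζ k) (x i) (x j) ^ (2 * m) ∂(piM L μ) else 0) + (if i ≠ j then ∫ x, DR d L x * tt (ζ k) (x i) (x j) ^ (2 * m + 1) ∂(piM L μ) else 0) := by
    intro i j k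
    have := ht k i j
    split_ifs
    · rw [integral_add (rint (by fun_prop)) (rint (by fun_prop))]
    · simp
  simp_rw [e3]
  simp_rw [Finset.sum_comm (t := (Finset.univ : Finset κ)), Finset.sum_add_distrib]
  simp_rw [E_t_odd L h, E_t_even L h _ (hζ _)]
  simp only [Finset.sum_const, Finset.card_univ, nsmul_eq_mul, JJ, aa, add_zero]
  simp
  ring
end PartG

section PartH
open MeasureTheory ComplexConjugate

theorem exists_config {d : ℕ} (hd : 1 ≤ d) (L : ℕ) (hL : 1 ≤ L) {κ : Type} [Fintype κ]
    (ζ : κ → ℂ) (hζ : ∀ k, ‖ζ k‖ = 1) :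
    ∃ x : mI d L → SC d, (∀ i j k, i ≠ j → |tt (ζ k) (x i) (x j)| < 1) ∧
      (∑ i : mI d L, ∑ j : mI d L, if i ≠ j then ∑ k, 1 / (1 - tt (ζ k) (x i) (x j)) else 0)
       ≤ Fintype.card κ * ((L + d).choose d : ℝ) ^ 2 * (2 * d / (2 * d - 1) - TT d L) := by
  obtain ⟨μ, hμ, hm⟩ := exists_measure d
  replace hm : MomP d μ := hm
  have hr : 2 ≤ (L + d).choose d := by
    have h1 := Nat.choose_le_choose d (show d + 1 ≤ L + d by omega)
    rw [Nat.choose_succ_self_right] at h1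
    omega
  set r : ℕ := (L + d).choose d with hrdef
  have hfac : (0 : ℝ) < (r.factorial : ℝ) := by exact_mod_cast Nat.factorial_pos _
  set π := piM L μ with hπ
  set f : ℕ → (mI d L → SC d) → ℝ := fun m x => ∑ i : mI d L, ∑ j : mI d L, if i ≠ j then ∑ k, (1 + tt (ζ k) (x i) (x j)) * tt (ζ k) (x i) (x j) ^ (2 * m) else 0 with hf
  have hDc := DR_cont d L
  have hD0 : ∀ x, 0 ≤ DR d L x := fun x => Complex.normSq_nonneg _
  have hfc : ∀ m, Continuous (f m) := by
    intro m
    refine continuous_finsetSum _ fun i _ => continuous_finsetSum _ fun j _ => ?_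
    split_ifs
    · refine continuous_finsetSum _ fun k _ => ?_
      have := tt_cont (ζ k) (cont_ev (d := d) i) (cont_ev j)
      fun_prop
    · fun_prop
  have hf0 : ∀ m x, 0 ≤ f m x := by
    intro m x
    refine Finset.sum_nonneg fun i _ => Finset.sum_nonneg fun j _ => ?_
    split_ifs
    · refine Finset.sum_nonneg fun k _ => mul_nonneg ?_ ?_
      · have := tt_ge (hζ k) (x i) (x j); linarith
      · rw [pow_mul]; positivity
    · exact le_rfl
  set B : ℝ := Fintype.card κ * (r : ℝ) ^ 2 * (2 * d / (2 * d - 1) - TT d L) with hB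
  have hint : ∀ m, ∫ x, DR d L x / r.factorial * f m x ∂π = Fintype.card κ * (r : ℝ) ^ 2 * (aa d 0 m - aa d L m) := by
    intro m
    have := E_step L hm ζ hζ m
    have e : ∀ x, DR d L x / r.factorial * f m x = (r.factorial : ℝ)⁻¹ * (DR d L x * f m x) := by
      intro x; ring
    simp_rw [e]
    rw [integral_const_mul, this, ← hrdef, inv_mul_cancel_left₀ hfac.ne']
  have hBs : HasSum (fun m => Fintype.card κ * (r : ℝ) ^ 2 * (aa d 0 m - aa d L m)) B := by
    have h1 := aa_hasSum d 0 hd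
    have h2 := aa_hasSum d L hd
    have h3 : TT d 0 = 2 * d / (2 * d - 1) := by simp [TT]
    rw [h3] at h1
    exact (h1.sub h2).mul_left _
  have hpos : ∀ m, 0 ≤ Fintype.card κ * (r : ℝ) ^ 2 * (aa d 0 m - aa d L m) := by
    intro m; rw [← hint]
    exact integral_nonneg fun x => mul_nonneg (div_nonneg (hD0 x) hfac.le) (hf0 m x)
  have hB0 : 0 ≤ B := hBs.nonneg hpos
  let ρ : (mI d L → SC d) → ENNReal := fun x => ENNReal.ofReal (DR d L x / r.factorial)
  have hρ : Measurable ρ := by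
    apply Measurable.ennreal_ofReal
    exact (hDc.measurable).div_const _
  let ν := π.withDensity ρ
  have hν : IsProbabilityMeasure ν := by
    constructor
    rw [withDensity_apply _ MeasurableSet.univ, setLIntegral_univ,
      ← ofReal_integral_eq_lintegral_ofReal (rint (by fun_prop)) (ae_of_all _ fun x => div_nonneg (hD0 x) hfac.le), integral_div, DR_mass hm hr, div_self hfac.ne']
    simp
  let G : (mI d L → SC d) → ENNReal := fun x => ∑' m, ENNReal.ofReal (f m x)
  have hG : Measurable G := Measurable.tsum fun m => (hfc m).measurable.ennreal_ofReal
  have hGint : ∫⁻ x, G x ∂ν = ENNReal.ofReal B := by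
    rw [lintegral_tsum (fun m => (hfc m).measurable.ennreal_ofReal.aemeasurable)]
    have : ∀ m, ∫⁻ x, ENNReal.ofReal (f m x) ∂ν = ENNReal.ofReal (Fintype.card κ * (r : ℝ) ^ 2 * (aa d 0 m - aa d L m)) := by
      intro m
      rw [lintegral_withDensity_eq_lintegral_mul _ hρ (hfc m).measurable.ennreal_ofReal, ← hint m,
        ofReal_integral_eq_lintegral_ofReal (rint (by have := hfc m; fun_prop)) (ae_of_all _ fun x => mul_nonneg (div_nonneg (hD0 x) hfac.le) (hf0 m x))]
      refine lintegral_congr fun x => ?_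
      simp only [Pi.mul_apply, ρ]
      rw [ENNReal.ofReal_mul (div_nonneg (hD0 x) hfac.le)]
    simp_rw [this]
    rw [← ENNReal.ofReal_tsum_of_nonneg hpos hBs.summable, hBs.tsum_eq]
  have hN : ν {x | DR d L x = 0} = 0 := by
    have hms : MeasurableSet {x | DR d L x = 0} := hDc.measurable (measurableSet_singleton 0)
    rw [withDensity_apply _ hms]
    rw [setLIntegral_congr_fun (g := fun _ => 0) hms]
    · simp
    · intro x hx
      have : DR d L x = 0 := hx
      simp [ρ, this]
  obtain ⟨x, hxN, hx⟩ := exists_notMem_null_le_lintegral hG.aemeasurable hN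
  have hDx : DD (phi d L) x ≠ 0 := by
    intro h; apply hxN; simp [DR, h]
  have hlt : ∀ i j k, i ≠ j → |tt (ζ k) (x i) (x j)| < 1 := fun i j k hij => tt_abs_lt x hDx i j hij (hζ k)
  refine ⟨x, hlt, ?_⟩
  have hS : HasSum (fun m => f m x) (∑ i : mI d L, ∑ j : mI d L, if i ≠ j then ∑ k, 1 / (1 - tt (ζ k) (x i) (x j)) else 0) := by
    refine hasSum_sum fun i _ => hasSum_sum fun j _ => ?_
    split_ifs with hij
    · exact hasSum_sum fun k _ => geom_t (hlt i j k hij)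
    · exact hasSum_zero
  rw [hGint] at hx
  have hx' : ENNReal.ofReal (∑' m, f m x) ≤ ENNReal.ofReal B := by
    rw [ENNReal.ofReal_tsum_of_nonneg (fun m => hf0 m x) hS.summable]; exact hx
  rw [ENNReal.ofReal_le_ofReal_iff hB0, hS.tsum_eq] at hx'
  exact hx'
end PartH

section PartI
open ComplexConjugate



lemma exists_iso (d : ℕ) : Nonempty (EuclideanSpace ℂ (Fin (d + 1)) ≃ₗᵢ[ℝ] EuclideanSpace ℝ (Fin (2 * d + 2))) := by
  have h : Module.finrank ℝ (EuclideanSpace ℂ (Fin (d + 1))) = 2 * d + 2 := by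
    rw [finrank_real_of_complex, finrank_euclideanSpace_fin]; ring
  exact ⟨((stdOrthonormalBasis ℝ (EuclideanSpace ℂ (Fin (d + 1)))).reindex (finCongr h)).repr⟩

lemma riesz_le {d : ℕ} {κ : Type} [Fintype κ] [DecidableEq κ] (y : κ → Fin (d + 1) → ℂ) 
    (hy : ∀ i, ∑ j, ‖y i j‖ ^ 2 = 1) (hinj : Function.Injective y) :
    riesz2MinEnergy d (Fintype.card κ) ≤ ∑ i, ∑ j, if i ≠ j then 1 / (∑ l, ‖y i l - y j l‖ ^ 2) else 0 := by
  obtain ⟨e⟩ := exists_iso d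
  let σ := Fintype.equivFin κ
  have hn : ∀ v : Fin (d + 1) → ℂ, ‖e (WithLp.toLp 2 v)‖ ^ 2 = ∑ l, ‖v l‖ ^ 2 := by
    intro v
    rw [e.norm_map, EuclideanSpace.norm_sq_eq]
  refine csInf_le ⟨0, ?_⟩ ⟨fun i => ⟨e (WithLp.toLp 2 (y (σ.symm i))), ?_⟩, ?_, ?_⟩
  · rintro E ⟨x, -, rfl⟩
    refine Finset.sum_nonneg fun i _ => Finset.sum_nonneg fun j _ => ?_
    split_ifs <;> positivity
  · rw [mem_sphere_zero_iff_norm, ← sq_eq_sq₀ (norm_nonneg _) zero_le_one, hn, hy]; simp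
  · intro i j hij
    simp only [Subtype.mk.injEq, EmbeddingLike.apply_eq_iff_eq] at hij
    have := hinj (WithLp.toLp_injective 2 hij)
    exact σ.symm.injective this
  · simp only [← map_sub, ← WithLp.toLp_sub, hn, Pi.sub_apply]
    rw [← Equiv.sum_comp σ]
    refine Finset.sum_congr rfl fun i _ => ?_
    rw [← Equiv.sum_comp σ]
    refine Finset.sum_congr rfl fun j _ => ?_
    simp

lemma le_riesz {d n : ℕ} {B : ℝ} (hB : ∀ (y : Fin n → Fin (d + 1) → ℂ), (∀ i, ∑ j, ‖y i j‖ ^ 2 = 1) → Function.Injective y →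
    B ≤ ∑ i, ∑ j, if i ≠ j then 1 / (∑ l, ‖y i l - y j l‖ ^ 2) else 0) : B ≤ riesz2MinEnergy d n := by
  obtain ⟨e⟩ := exists_iso d
  refine le_csInf ?_ ?_
  · have hinf : Infinite (sphere (0 : EuclideanSpace ℝ (Fin (2 * d + 2))) 1) := by
      have hr : 1 < Module.rank ℝ (EuclideanSpace ℝ (Fin (2 * d + 2))) := by
        rw [← Module.finrank_eq_rank, finrank_euclideanSpace_fin]
        exact_mod_cast (by omega : 1 < 2 * d + 2)
      have hp := isPreconnected_sphere hr (0 : EuclideanSpace ℝ (Fin (2 * d + 2))) 1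
      rw [Set.infinite_coe_iff]
      refine hp.infinite_of_nontrivial ?_
      refine ⟨EuclideanSpace.single 0 1, by simp, -EuclideanSpace.single 0 1, by simp, ?_⟩
      intro h
      have := congrArg (fun v => v 0) h
      simp at this
      linarith
    let x : Fin n ↪ sphere (0 : EuclideanSpace ℝ (Fin (2 * d + 2))) 1 := Fin.valEmbedding.trans (Infinite.natEmbedding _)
    exact ⟨_, x, x.injective, rfl⟩
  · rintro E ⟨x, hx, rfl⟩
    have hn : ∀ v : EuclideanSpace ℝ (Fin (2 * d + 2)), ∑ l, ‖e.symm v l‖ ^ 2 = ‖v‖ ^ 2 := by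
      intro v
      rw [← EuclideanSpace.norm_sq_eq, LinearIsometryEquiv.norm_map]
    have := hB (fun i => WithLp.ofLp (e.symm (x i))) ?_ ?_
    · refine this.trans (le_of_eq ?_)
      refine Finset.sum_congr rfl fun i _ => Finset.sum_congr rfl fun j _ => ?_
      rw [← hn, map_sub]; rfl
    · intro i; rw [hn, mem_sphere_zero_iff_norm.1 (x i).2]; simp
    · intro i j hij
      have := WithLp.ofLp_injective 2 hij
      exact hx (Subtype.ext (e.symm.injective this))

lemma sum_j_pow (z : ℂ) (n : ℕ) : (z - 1) * ∑ j ∈ Finset.range n, (j : ℂ) * z ^ j = n * z ^ n - z * ∑ j ∈ Finset.range n, z ^ j := by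
  induction n with
  | zero => simp
  | succ n ih =>
    rw [Finset.sum_range_succ, mul_add, ih, Finset.sum_range_succ]
    push_cast
    ring

lemma geom_zero {z : ℂ} {k : ℕ} (h1 : z ≠ 1) (hk : z ^ k = 1) : ∑ j ∈ Finset.range k, z ^ j = 0 := by
  have := mul_geom_sum z k
  rw [hk, sub_self] at this
  exact (mul_eq_zero.1 this).resolve_left (sub_ne_zero.2 h1)

lemma sum_j (k : ℕ) : ∑ j ∈ Finset.range k, (j : ℝ) = k * (k - 1) / 2 := by
  induction k with
  | zero => simp
  | succ k ih => rw [Finset.sum_range_succ, ih]; push_cast; ring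

lemma sum_j_sq (k : ℕ) : ∑ j ∈ Finset.range k, (j : ℝ) ^ 2 = k * (k - 1) * (2 * k - 1) / 6 := by
  induction k with
  | zero => simp
  | succ k ih => rw [Finset.sum_range_succ, ih]; push_cast; ring

lemma root_norm {ω : ℂ} {k : ℕ} (hk : 1 ≤ k) (hω : IsPrimitiveRoot ω k) : ‖ω‖ = 1 :=
  hω.norm'_eq_one (by omega)

lemma fiber_sum {ω : ℂ} {k : ℕ} (hk : 1 ≤ k) (hω : IsPrimitiveRoot ω k) :
    ∑ l ∈ Finset.range k, ∑ m ∈ Finset.range k, (if l ≠ m then 1 / ‖ω ^ l - ω ^ m‖ ^ 2 else 0) = (k : ℝ) * (k ^ 2 - 1) / 12 := by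
  have hn := root_norm hk hω
  have hk0 : (k : ℝ) ≠ 0 := by positivity
  have hc : ω * conj ω = 1 := by rw [Complex.mul_conj, Complex.normSq_eq_norm_sq, hn]; simp
  have hwk : ∀ a b : ℕ, (ω ^ a * conj ω ^ b) ^ k = 1 := by
    intro a b
    rw [mul_pow, ← pow_mul, ← pow_mul, mul_comm a, mul_comm b, pow_mul, pow_mul, hω.pow_eq_one, ← map_pow, hω.pow_eq_one]; simp
  have hw1 : ∀ a ∈ Finset.range k, ∀ b ∈ Finset.range k, ω ^ a * conj ω ^ b = 1 → a = b := by
    intro a ha b hb h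
    apply hω.pow_inj (Finset.mem_range.1 ha) (Finset.mem_range.1 hb)
    calc ω ^ a = ω ^ a * (ω * conj ω) ^ b := by rw [hc]; simp
      _ = (ω ^ a * conj ω ^ b) * ω ^ b := by rw [mul_pow]; ring
      _ = _ := by rw [h, one_mul]
  -- Parseval
  have par : ∑ l ∈ Finset.range k, ∑ m ∈ Finset.range k, ‖∑ j ∈ Finset.range k, (j : ℂ) * (ω ^ l * conj ω ^ m) ^ j‖ ^ 2
      = k ^ 2 * ∑ j ∈ Finset.range k, (j : ℝ) ^ 2 := by
    rw [← Complex.ofReal_inj]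
    push_cast
    have e1 : ∀ l m : ℕ, (((‖∑ j ∈ Finset.range k, (j : ℂ) * (ω ^ l * conj ω ^ m) ^ j‖ : ℝ) : ℂ)) ^ 2
       = ∑ j ∈ Finset.range k, ∑ j' ∈ Finset.range k, (j : ℂ) * j' * ((ω ^ j * conj ω ^ j') ^ l * conj (ω ^ j * conj ω ^ j') ^ m) := by
      intro l m
      rw [← Complex.mul_conj', map_sum, Finset.sum_mul_sum]
      refine Finset.sum_congr rfl fun j _ => Finset.sum_congr rfl fun j' _ => ?_
      simp only [map_mul, map_pow, Complex.conj_conj, map_natCast, mul_pow, ← pow_mul]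
      rw [mul_comm l j, mul_comm l j', mul_comm m j, mul_comm m j']
      ring
    simp_rw [e1]
    have e2 : ∀ f : ℕ → ℕ → ℕ → ℕ → ℂ, ∑ l ∈ Finset.range k, ∑ m ∈ Finset.range k, ∑ j ∈ Finset.range k, ∑ j' ∈ Finset.range k, f l m j j'
       = ∑ j ∈ Finset.range k, ∑ j' ∈ Finset.range k, ∑ l ∈ Finset.range k, ∑ m ∈ Finset.range k, f l m j j' := by
      intro f
      calc _ = ∑ l ∈ Finset.range k, ∑ j ∈ Finset.range k, ∑ m ∈ Finset.range k, ∑ j' ∈ Finset.range k, f l m j j' :=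
            Finset.sum_congr rfl fun l _ => Finset.sum_comm
        _ = ∑ l ∈ Finset.range k, ∑ j ∈ Finset.range k, ∑ j' ∈ Finset.range k, ∑ m ∈ Finset.range k, f l m j j' :=
            Finset.sum_congr rfl fun l _ => Finset.sum_congr rfl fun j _ => Finset.sum_comm
        _ = ∑ j ∈ Finset.range k, ∑ l ∈ Finset.range k, ∑ j' ∈ Finset.range k, ∑ m ∈ Finset.range k, f l m j j' := Finset.sum_comm
        _ = _ := Finset.sum_congr rfl fun j _ => Finset.sum_comm
    rw [e2, Finset.mul_sum]
    refine Finset.sum_congr rfl fun j hj => ?_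
    have e3 : ∀ j' ∈ Finset.range k, ∑ l ∈ Finset.range k, ∑ m ∈ Finset.range k, (j : ℂ) * j' * ((ω ^ j * conj ω ^ j') ^ l * conj (ω ^ j * conj ω ^ j') ^ m)
       = if j = j' then (k : ℂ) ^ 2 * j ^ 2 else 0 := by
      intro j' hj'
      simp_rw [← Finset.mul_sum, ← Finset.sum_mul]
      split_ifs with h
      · subst h
        have : ω ^ j * conj ω ^ j = 1 := by rw [← mul_pow, hc, one_pow]
        rw [this]
        simp
        ring
      · rw [geom_zero (fun hh => h (hw1 j hj j' hj' hh)) (hwk _ _)]; simp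
    rw [Finset.sum_congr rfl e3, Finset.sum_ite_eq, if_pos hj]
  have term : ∀ l ∈ Finset.range k, ∀ m ∈ Finset.range k, (if l ≠ m then 1 / ‖ω ^ l - ω ^ m‖ ^ 2 else 0)
      = (‖∑ j ∈ Finset.range k, (j : ℂ) * (ω ^ l * conj ω ^ m) ^ j‖ ^ 2 - if l = m then ((k : ℝ) * (k - 1) / 2) ^ 2 else 0) / k ^ 2 := by
    intro l hl m hm
    by_cases h : l = m
    · subst h
      have : ω ^ l * conj ω ^ l = 1 := by rw [← mul_pow, hc, one_pow]
      rw [this]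
      simp only [one_pow, mul_one, ne_eq, not_true, if_false, if_true]
      have : (∑ j ∈ Finset.range k, (j : ℂ)) = ((∑ j ∈ Finset.range k, (j : ℝ) : ℝ) : ℂ) := by push_cast; rfl
      rw [this, sum_j, Complex.norm_real, Real.norm_eq_abs, sq_abs, sub_self, zero_div]
    · simp only [ne_eq, h, not_false_eq_true, if_true, if_false, sub_zero]
      set z := ω ^ l * conj ω ^ m with hz
      have hz1 : z ≠ 1 := fun hh => h (hw1 l hl m hm hh)
      have h1 := sum_j_pow z k
      rw [geom_zero hz1 (hwk l m), hwk l m, mul_zero, sub_zero, mul_one] at h1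
      have h2 := congrArg norm h1
      rw [norm_mul, Complex.norm_natCast] at h2
      have h3 : ‖z - 1‖ = ‖ω ^ l - ω ^ m‖ := by
        have : ω ^ l - ω ^ m = (z - 1) * ω ^ m := by
          rw [hz]
          have : conj ω ^ m * ω ^ m = 1 := by rw [← mul_pow, mul_comm, hc, one_pow]
          linear_combination (-ω ^ l) * this
        rw [this, norm_mul, norm_pow, hn]; simp
      rw [h3] at h2
      have h4 : ‖ω ^ l - ω ^ m‖ ≠ 0 := by
        intro h0; rw [h0, zero_mul] at h2; exact hk0 h2.symm
      rw [div_eq_div_iff (by positivity) (by positivity), ← h2]; ring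
  rw [Finset.sum_congr rfl fun l hl => Finset.sum_congr rfl fun m hm => term l hl m hm]
  simp_rw [← Finset.sum_div, Finset.sum_sub_distrib]
  rw [par, sum_j_sq]
  have e5 : ∑ l ∈ Finset.range k, ∑ m ∈ Finset.range k, (if l = m then ((k : ℝ) * (k - 1) / 2) ^ 2 else 0) = k * ((k : ℝ) * (k - 1) / 2) ^ 2 := by
    rw [Finset.sum_congr rfl (fun l hl => by rw [Finset.sum_ite_eq, if_pos hl])]
    simp
  rw [e5]
  field_simp
  ring
end PartI

section PartJ
open ComplexConjugate

theorem riesz_upper {d : ℕ} (hd : 1 ≤ d) (L k : ℕ) (hL : 1 ≤ L) (hk : 1 ≤ k) :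
    riesz2MinEnergy d ((L + d).choose d * k) ≤
      (((L + d).choose d : ℝ) * k) ^ 2 * (d / (2 * d - 1) - TT d L / 2) + ((L + d).choose d : ℝ) * (k * (k ^ 2 - 1) / 12) := by
  have hω := Complex.isPrimitiveRoot_exp k (by omega)
  set ω := Complex.exp (2 * Real.pi * Complex.I / k) with hωdef
  have hn : ‖ω‖ = 1 := root_norm hk hω
  have hcard : Fintype.card (mI d L) = (L + d).choose d := by rw [Fintype.card_coe, card_mI]
  have hcc : ω * conj ω = 1 := by rw [Complex.mul_conj, Complex.normSq_eq_norm_sq, hn]; simp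
  let ζ : Fin k × Fin k → ℂ := fun a => ω ^ (a.1 : ℕ) * conj ω ^ (a.2 : ℕ)
  have hζ : ∀ a, ‖ζ a‖ = 1 := by
    intro a; simp [ζ, hn]
  obtain ⟨x, hlt, hx⟩ := exists_config hd L hL ζ hζ
  let y : mI d L × Fin k → Fin (d + 1) → ℂ := fun a c => ω ^ (a.2 : ℕ) * zz (x a.1) c
  have hxn : ∀ i, ∑ c, ‖zz (x i) c‖ ^ 2 = 1 := fun i => (x i).2
  have hy : ∀ a, ∑ c, ‖y a c‖ ^ 2 = 1 := by
    intro a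
    simp only [y, norm_mul, norm_pow, hn, one_pow, one_mul]
    exact hxn _
  have hdist : ∀ i j l m, ∑ c, ‖y (i, l) c - y (j, m) c‖ ^ 2 = 2 - 2 * tt (ζ (l, m)) (x i) (x j) := by
    intro i j l m
    rw [← tt_dist (hζ _)]
    refine Finset.sum_congr rfl fun c _ => ?_
    have h1 : y (i, l) c - y (j, m) c = ω ^ (m : ℕ) * (ζ (l, m) * zz (x i) c - zz (x j) c) := by
      simp only [y, ζ]
      have : ω ^ (m : ℕ) * conj ω ^ (m : ℕ) = 1 := by rw [← mul_pow, hcc, one_pow]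
      linear_combination (- ω ^ (l : ℕ) * zz (x i) c) * this
    rw [h1, norm_mul, norm_pow, hn, one_pow, one_mul]
  have hdist2 : ∀ i l m, ∑ c, ‖y (i, l) c - y (i, m) c‖ ^ 2 = ‖ω ^ (l : ℕ) - ω ^ (m : ℕ)‖ ^ 2 := by
    intro i l m
    simp only [y, ← sub_mul, norm_mul, mul_pow, ← Finset.mul_sum, hxn, mul_one]
  have hinj : Function.Injective y := by
    rintro ⟨i, l⟩ ⟨j, m⟩ h
    by_cases hij : i = j
    · subst hij
      have h2 := hdist2 i l m
      rw [h] at h2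
      simp at h2
      have h3 := hω.pow_inj l.2 m.2 (sub_eq_zero.1 (norm_eq_zero.1 ((pow_eq_zero_iff two_ne_zero).1 h2.symm)))
      rw [Fin.ext h3]
    · exfalso
      have h2 := hdist i j l m
      rw [h] at h2
      simp at h2
      have h3 := (abs_lt.1 (hlt i j (l, m) hij)).2
      linarith
  have key := riesz_le y hy hinj
  have hc2 : Fintype.card (mI d L × Fin k) = (L + d).choose d * k := by rw [Fintype.card_prod, hcard, Fintype.card_fin]
  rw [hc2] at key
  refine key.trans ?_
  have e1 : (∑ a, ∑ b, if a ≠ b then 1 / (∑ c, ‖y a c - y b c‖ ^ 2) else 0) =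
     (∑ i : mI d L, ∑ j : mI d L, if i ≠ j then ∑ a, 1 / (1 - tt (ζ a) (x i) (x j)) else 0) / 2
      + ∑ i : mI d L, ∑ l : Fin k, ∑ m : Fin k, if l ≠ m then 1 / ‖ω ^ (l : ℕ) - ω ^ (m : ℕ)‖ ^ 2 else 0 := by
    have e2 : ∀ i : mI d L, (∑ l : Fin k, ∑ m : Fin k, if l ≠ m then 1 / ‖ω ^ (l : ℕ) - ω ^ (m : ℕ)‖ ^ 2 else 0)
       = ∑ j : mI d L, if i = j then (∑ l : Fin k, ∑ m : Fin k, if l ≠ m then 1 / ‖ω ^ (l : ℕ) - ω ^ (m : ℕ)‖ ^ 2 else 0) else 0 := by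
      intro i; simp
    rw [Finset.sum_congr rfl fun i _ => e2 i, Finset.sum_div, ← Finset.sum_add_distrib]
    simp_rw [Finset.sum_div, ← Finset.sum_add_distrib, Fintype.sum_prod_type]
    refine Finset.sum_congr rfl fun i _ => ?_
    rw [Finset.sum_comm]
    refine Finset.sum_congr rfl fun j _ => ?_
    by_cases hij : i = j
    · subst hij
      simp only [ne_eq, not_true, if_false, if_true, zero_div, zero_add, Prod.mk.injEq, true_and]
      simp_rw [hdist2]
    · simp only [ne_eq, hij, not_false_eq_true, if_true, if_false, add_zero, Prod.mk.injEq, false_and]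
      rw [Finset.sum_div]
      refine Finset.sum_congr rfl fun l _ => ?_
      rw [Finset.sum_div]
      refine Finset.sum_congr rfl fun m _ => ?_
      rw [hdist]
      rw [show 2 - 2 * tt (ζ (l, m)) (x i) (x j) = (1 - tt (ζ (l, m)) (x i) (x j)) * 2 by ring, div_div]
  have e3 : (∑ l : Fin k, ∑ m : Fin k, if l ≠ m then 1 / ‖ω ^ (l : ℕ) - ω ^ (m : ℕ)‖ ^ 2 else 0) = (k : ℝ) * (k ^ 2 - 1) / 12 := by
    rw [← fiber_sum hk hω, Finset.sum_range]
    refine Finset.sum_congr rfl fun l _ => ?_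
    rw [Finset.sum_range]
    refine Finset.sum_congr rfl fun m _ => ?_
    simp [Fin.ext_iff]
  rw [e1, e3, Finset.sum_const, Finset.card_univ, hcard, nsmul_eq_mul]
  have e4 : (Fintype.card (Fin k × Fin k) : ℝ) = k ^ 2 := by simp; ring
  rw [e4] at hx
  have : (((L + d).choose d : ℝ) * k) ^ 2 * (d / (2 * d - 1) - TT d L / 2) = ((k : ℝ) ^ 2 * ((L + d).choose d : ℝ) ^ 2 * (2 * d / (2 * d - 1) - TT d L)) / 2 := by ring
  rw [this]
  linarith
end PartJ

lemma const_eq {d f g : ℝ} (hd : 1 ≤ d) (hf : 0 < f) (hg : 0 < g) :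
    (3 : ℝ) ^ (1 - 2 / (2 * d + 1)) * (2 * d - 1) ^ (1 - 2 / (2 * d + 1)) *
        (2 * d + 1) * g ^ (2 - 2 / (2 * d + 1)) /
      ((2 : ℝ) ^ (4 - 2 / (2 * d + 1)) * f ^ (2 - 4 / (2 * d + 1)))
    = (3 * (2 * d - 1) * g / (2 * f) / f) ^ (1 - 2 / (2 * d + 1)) * (d * g) / 2
       - (3 * (2 * d - 1) * g / (2 * f)) ^ 2 * (3 * (2 * d - 1) * g / (2 * f) / f) ^ (-(2 / (2 * d + 1))) / 12 := by
  set e := 2 / (2 * d + 1) with he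
  have he4 : 4 / (2 * d + 1) = 2 * e := by rw [he]; ring
  have h2 : 0 < 2 * d - 1 := by linarith
  rw [he4]
  set w := 3 * (2 * d - 1) * g / (2 * f) / f with hw
  have hwpos : 0 < w := by positivity
  have e1 : w ^ (-e) = w ^ (1 - e) / w := by
    rw [show 1 - e = -e + 1 by ring, Real.rpow_add_one hwpos.ne']; field_simp
  rw [e1]
  have e2 : w ^ (1 - e) = 3 ^ (1 - e) * (2 * d - 1) ^ (1 - e) * g ^ (1 - e) / (2 ^ (1 - e) * f ^ (1 - e) * f ^ (1 - e)) := by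
    rw [hw, Real.div_rpow (by positivity) hf.le, Real.div_rpow (by positivity) (by positivity), Real.mul_rpow (by positivity) hg.le,
      Real.mul_rpow (by norm_num) h2.le, Real.mul_rpow (by norm_num) hf.le]
    field_simp
  have e3 : g ^ (2 - e) = g ^ (1 - e) * g := by rw [← Real.rpow_add_one hg.ne']; ring_nf
  have e4 : f ^ (2 - 2 * e) = f ^ (1 - e) * f ^ (1 - e) := by rw [← Real.rpow_add hf]; ring_nf
  have e5 : (2 : ℝ) ^ (4 - e) = 2 ^ (1 - e) * 8 := by
    rw [show (4 : ℝ) - e = (1 - e) + (3 : ℕ) by push_cast; ring, Real.rpow_add_natCast (by norm_num)]; norm_num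
  have e6 : (3 * (2 * d - 1) * g / (2 * f)) ^ 2 * (w ^ (1 - e) / w) / 12 = w ^ (1 - e) * ((2 * d - 1) * g / 8) := by
    rw [hw]; field_simp; ring
  rw [e6, e3, e4, e5, e2]
  have p1 : 0 < f ^ (1 - e) := by positivity
  have p2 : (0 : ℝ) < 2 ^ (1 - e) := by positivity
  field_simp
  ring

noncomputable def uu (d n : ℕ) : ℝ := ((d : ℝ) / (2 * (d : ℝ) - 1) * (n : ℝ) ^ 2 - riesz2MinEnergy d n) /
          (n : ℝ) ^ (1 + 2 / (2 * (d : ℝ) + 1))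

lemma choose_lo (L d : ℕ) : ((L : ℝ) + 1) ^ d / d.factorial ≤ ((L + d).choose d : ℝ) := by
  have := Nat.pow_le_choose (α := ℝ) d (L + d)
  rw [show L + d + 1 - d = L + 1 by omega] at this
  exact_mod_cast this

lemma choose_hi (L d : ℕ) : ((L + d).choose d : ℝ) ≤ ((L : ℝ) + d) ^ d / d.factorial := by
  have := Nat.choose_le_pow_div (α := ℝ) d (L + d)
  exact_mod_cast this

lemma choose_tendsto (d : ℕ) : Tendsto (fun L : ℕ => ((L + d).choose d : ℝ) / (L : ℝ) ^ d) atTop (nhds (1 / d.factorial)) := by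
  have hf : (0 : ℝ) < d.factorial := by exact_mod_cast Nat.factorial_pos _
  have h0 : Tendsto (fun L : ℕ => (d : ℝ) / L) atTop (nhds 0) := tendsto_const_div_atTop_nhds_zero_nat _
  have h1 : Tendsto (fun L : ℕ => (1 + (d : ℝ) / L) ^ d / d.factorial) atTop (nhds (1 / d.factorial)) := by
    have := ((h0.const_add 1).pow d).div_const (d.factorial : ℝ)
    simpa using this
  refine tendsto_of_tendsto_of_tendsto_of_le_of_le' (tendsto_const_nhds (x := 1 / (d.factorial : ℝ))) h1 ?_ ?_
  · filter_upwards [eventually_ge_atTop 1] with L hL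
    have hL' : (0 : ℝ) < L := by exact_mod_cast hL
    rw [le_div_iff₀ (by positivity)]
    refine le_trans ?_ (choose_lo L d)
    rw [one_div, inv_mul_eq_div]
    gcongr; linarith
  · filter_upwards [eventually_ge_atTop 1] with L hL
    have hL' : (0 : ℝ) < L := by exact_mod_cast hL
    rw [div_le_iff₀ (by positivity)]
    refine (choose_hi L d).trans (le_of_eq ?_)
    rw [div_mul_eq_mul_div, ← mul_pow]
    congr 2
    field_simp

lemma uu_bdd (d : ℕ) (hd : 1 ≤ d) : IsBoundedUnder (· ≤ ·) atTop (uu d) := by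
  have hd' : (1 : ℝ) ≤ d := by exact_mod_cast hd
  have hf : (0 : ℝ) < d.factorial := by exact_mod_cast Nat.factorial_pos _
  refine ⟨(1 + d) * d.factorial / (2 * d - 1) + 2, ?_⟩
  rw [eventually_map]
  filter_upwards [eventually_ge_atTop 1] with n hn
  have hn1 : (1 : ℝ) ≤ n := by exact_mod_cast hn
  have hn0 : (0 : ℝ) < n := by linarith
  set e : ℝ := 2 / (2 * (d : ℝ) + 1) with he
  have he0 : 0 < e := by positivity
  set K := ⌈(n : ℝ) ^ e⌉₊ with hK
  have hKge : (n : ℝ) ^ e ≤ K := Nat.le_ceil _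
  have hne : (1 : ℝ) ≤ (n : ℝ) ^ e := Real.one_le_rpow hn1 he0.le
  have hKle : (K : ℝ) ≤ 2 * (n : ℝ) ^ e := by
    have := Nat.ceil_lt_add_one (show 0 ≤ (n : ℝ) ^ e by positivity)
    rw [← hK] at this; linarith
  have hK1 : (1 : ℝ) ≤ K := hne.trans hKge
  have hK0 : (0 : ℝ) < K := by linarith
  have hE : (n : ℝ) ^ 2 * (d / (2 * d - 1) - (K + d) / (2 * d - 1) * aa d 0 K) - n * K ≤ riesz2MinEnergy d n :=
    le_riesz fun y hy hinj => energy_lower hd y hy hinj K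
  have hcc : cc K ≤ (K : ℝ) ^ (-(1 / 2) : ℝ) := by
    have h1 := cc_sq_le K
    have h2 := cc_pos K
    rw [Real.rpow_neg hK0.le, ← Real.sqrt_eq_rpow, ← one_div, le_div_iff₀ (Real.sqrt_pos.2 hK0)]
    refine abs_le_of_sq_le_sq' ?_ zero_le_one |>.2
    rw [mul_pow, Real.sq_sqrt hK0.le]
    nlinarith [sq_nonneg (cc K)]
  have haa : (K + d) * aa d 0 K ≤ (1 + d) * d.factorial * (K : ℝ) ^ (1 / 2 - d : ℝ) := by
    unfold aa
    have h1 := choose_lo K d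
    have hp : (K : ℝ) ^ d / d.factorial ≤ ((K + 0 + d).choose d : ℝ) := by
      refine le_trans ?_ h1; gcongr; linarith
    have hKd : (0 : ℝ) < (K : ℝ) ^ d / d.factorial := by positivity
    calc ((K : ℝ) + d) * (cc K / ((K + 0 + d).choose d : ℝ)) ≤ ((1 + d) * K) * ((K : ℝ) ^ (-(1 / 2) : ℝ) / ((K : ℝ) ^ d / d.factorial)) := by
          have : 0 ≤ cc K := (cc_pos K).le
          gcongr
          nlinarith
      _ = _ := by
          rw [show (1 / 2 - d : ℝ) = 1 + (-(1/2)) - d by ring, Real.rpow_sub hK0, Real.rpow_add hK0, Real.rpow_natCast, Real.rpow_one]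
          field_simp
  have hKp : (K : ℝ) ^ (1 / 2 - d : ℝ) ≤ (n : ℝ) ^ (e - 1) := by
    calc (K : ℝ) ^ (1 / 2 - d : ℝ) ≤ ((n : ℝ) ^ e) ^ (1 / 2 - d : ℝ) := 
          Real.rpow_le_rpow_of_nonpos (by positivity) hKge (by linarith)
      _ = _ := by
          rw [← Real.rpow_mul hn0.le]
          congr 1
          rw [he]; field_simp; ring
  have h2d : 0 < 2 * (d : ℝ) - 1 := by linarith
  unfold uu
  rw [← he, div_le_iff₀ (by positivity)]
  have hpow1 : (n : ℝ) ^ (1 + e) = n * n ^ e := by rw [Real.rpow_add hn0, Real.rpow_one]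
  have hpow2 : (n : ℝ) ^ (1 + e) = n ^ 2 * n ^ (e - 1) := by
    rw [← Real.rpow_natCast n 2, ← Real.rpow_add hn0]; congr 1; push_cast; ring
  have t1 : (n : ℝ) * K ≤ 2 * (n : ℝ) ^ (1 + e) := by rw [hpow1]; nlinarith
  have t2 : (n : ℝ) ^ 2 * ((K + d) / (2 * d - 1) * aa d 0 K) ≤ (1 + d) * d.factorial / (2 * d - 1) * (n : ℝ) ^ (1 + e) := by
    rw [hpow2]
    calc (n : ℝ) ^ 2 * ((K + d) / (2 * d - 1) * aa d 0 K) = (n : ℝ) ^ 2 / (2 * d - 1) * ((K + d) * aa d 0 K) := by ring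
      _ ≤ (n : ℝ) ^ 2 / (2 * d - 1) * ((1 + d) * d.factorial * (n : ℝ) ^ (e - 1)) := by
          refine mul_le_mul_of_nonneg_left (haa.trans ?_) (by positivity)
          exact mul_le_mul_of_nonneg_left hKp (by positivity)
      _ = _ := by ring
  nlinarith [hE, t1, t2]

lemma uu_lower (d : ℕ) (hd : 1 ≤ d) (L k : ℕ) (hL : 1 ≤ L) (hk : 1 ≤ k) :
    (((L + d).choose d * k : ℕ) : ℝ) ^ (1 - 2 / (2 * (d : ℝ) + 1)) * TT d L / 2 -
      (k : ℝ) ^ 2 * (((L + d).choose d * k : ℕ) : ℝ) ^ (-(2 / (2 * (d : ℝ) + 1))) / 12 ≤ uu d ((L + d).choose d * k) := by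
  have h := riesz_upper hd L k hL hk
  have hr : 0 < (L + d).choose d := Nat.choose_pos (by omega)
  set r := (L + d).choose d
  set n := r * k with hndef
  have hn : (n : ℝ) = r * k := by rw [hndef]; push_cast; rfl
  have hn0 : (0 : ℝ) < n := by exact_mod_cast Nat.mul_pos hr hk
  set e : ℝ := 2 / (2 * (d : ℝ) + 1) with he
  unfold uu
  rw [← he, le_div_iff₀ (by positivity)]
  have p1 : (n : ℝ) ^ (1 - e) * (n : ℝ) ^ (1 + e) = n ^ 2 := by
    rw [← Real.rpow_add hn0, ← Real.rpow_natCast]; congr 1; push_cast; ring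
  have p2 : (n : ℝ) ^ (-e) * (n : ℝ) ^ (1 + e) = n := by
    rw [← Real.rpow_add hn0]; simp
  have : ((n : ℝ) ^ (1 - e) * TT d L / 2 - (k : ℝ) ^ 2 * (n : ℝ) ^ (-e) / 12) * (n : ℝ) ^ (1 + e) = n ^ 2 * TT d L / 2 - k ^ 2 * n / 12 := by
    rw [← p1]
    nth_rewrite 6 [← p2]
    ring
  rw [this]
  rw [← hn] at h
  have h3 : (r : ℝ) * (k * (k ^ 2 - 1) / 12) ≤ k ^ 2 * n / 12 := by
    rw [hn]
    have : (0 : ℝ) ≤ r * k := by positivity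
    nlinarith
  nlinarith

theorem stmt0 (d : ℕ) (hd : 1 ≤ d) :
    (3 : ℝ) ^ (1 - 2 / (2 * (d : ℝ) + 1)) * (2 * (d : ℝ) - 1) ^ (1 - 2 / (2 * (d : ℝ) + 1)) *
        (2 * (d : ℝ) + 1) * Real.Gamma ((d : ℝ) - 1/2) ^ (2 - 2 / (2 * (d : ℝ) + 1)) /
      ((2 : ℝ) ^ (4 - 2 / (2 * (d : ℝ) + 1)) *
        (d.factorial : ℝ) ^ (2 - 4 / (2 * (d : ℝ) + 1)))
    ≤ limsup (fun n : ℕ =>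
        ((d : ℝ) / (2 * (d : ℝ) - 1) * (n : ℝ) ^ 2 - riesz2MinEnergy d n) /
          (n : ℝ) ^ (1 + 2 / (2 * (d : ℝ) + 1))) atTop := by
  change _ ≤ limsup (uu d) atTop
  have hd' : (1 : ℝ) ≤ d := by exact_mod_cast hd
  have hf : (0 : ℝ) < d.factorial := by exact_mod_cast Nat.factorial_pos _
  have hg : 0 < Real.Gamma ((d : ℝ) - 1 / 2) := Real.Gamma_pos_of_pos (by linarith)
  rw [const_eq hd' hf hg]
  set g := Real.Gamma ((d : ℝ) - 1 / 2) with hgdef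
  set c := 3 * (2 * (d : ℝ) - 1) * g / (2 * d.factorial) with hc
  have h2d : 0 < 2 * (d : ℝ) - 1 := by linarith
  have hc0 : 0 < c := by positivity
  set e : ℝ := 2 / (2 * (d : ℝ) + 1) with he
  let k : ℕ → ℕ := fun L => ⌊c * Real.sqrt L⌋₊
  let N : ℕ → ℕ := fun L => (L + d).choose d * k L
  have hsq : Tendsto (fun L : ℕ => Real.sqrt L) atTop atTop := Real.tendsto_sqrt_atTop.comp tendsto_natCast_atTop_atTop
  have hk : Tendsto (fun L => (k L : ℝ) / Real.sqrt L) atTop (nhds c) :=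
    (tendsto_nat_floor_mul_div_atTop hc0.le).comp hsq
  have hk1 : ∀ᶠ L in atTop, 1 ≤ k L := by
    filter_upwards [hsq.eventually_ge_atTop (1 / c)] with L hL
    apply Nat.le_floor
    rw [div_le_iff₀ hc0] at hL
    push_cast; linarith
  have hN : Tendsto N atTop atTop := by
    refine tendsto_atTop_mono' atTop ?_ tendsto_id
    filter_upwards [hk1] with L hL
    have h1 : L + 1 ≤ (L + d).choose d := by exact_mod_cast choose_ge L d hd
    simp only [id, N]
    nlinarith
  have hs : Tendsto (fun L : ℕ => (N L : ℝ) / (L : ℝ) ^ ((d : ℝ) + 1 / 2)) atTop (nhds (c / d.factorial)) := by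
    have := (choose_tendsto d).mul hk
    rw [show 1 / (d.factorial : ℝ) * c = c / d.factorial by ring] at this
    refine this.congr' ?_
    filter_upwards [eventually_ge_atTop 1] with L hL
    have hL' : (0 : ℝ) < L := by exact_mod_cast hL
    rw [Real.rpow_add hL', Real.rpow_natCast, ← Real.sqrt_eq_rpow]
    simp only [N]; push_cast
    rw [div_mul_div_comm]
  have hw : c / d.factorial ≠ 0 := by positivity
  have hlim : Tendsto (fun L : ℕ => (N L : ℝ) ^ (1 - e) * TT d L / 2 - (k L : ℝ) ^ 2 * (N L : ℝ) ^ (-e) / 12) atTop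
      (nhds ((c / d.factorial) ^ (1 - e) * (d * g) / 2 - c ^ 2 * (c / d.factorial) ^ (-e) / 12)) := by
    have l1 := ((hs.rpow_const (p := 1 - e) (Or.inl hw)).mul (TT_tendsto d hd)).div_const 2
    have l2 := ((hk.pow 2).mul (hs.rpow_const (p := -e) (Or.inl hw))).div_const 12
    refine (l1.sub l2).congr' ?_
    filter_upwards [eventually_ge_atTop 1] with L hL
    have hL' : (0 : ℝ) < L := by exact_mod_cast hL
    have q1 : ((d : ℝ) + 1 / 2) * (1 - e) = d - 1 / 2 := by rw [he]; field_simp; ring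
    have q2 : ((d : ℝ) + 1 / 2) * (-e) = -1 := by rw [he]; field_simp
    rw [Real.div_rpow (by positivity) (by positivity), Real.div_rpow (by positivity) (by positivity), ← Real.rpow_mul hL'.le, ← Real.rpow_mul hL'.le,
      q1, q2, div_pow, Real.sq_sqrt hL'.le, Real.rpow_neg_one]
    have : (L : ℝ) ^ ((d : ℝ) - 1 / 2) ≠ 0 := by positivity
    field_simp
  refine le_of_forall_lt fun a ha => ?_
  obtain ⟨b, hab, hb⟩ := exists_between ha
  refine lt_of_lt_of_le hab ?_
  refine le_limsup_of_frequently_le ?_ (uu_bdd d hd)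
  refine hN.frequently (Eventually.frequently ?_)
  filter_upwards [hlim.eventually_const_lt hb, hk1, eventually_ge_atTop 1] with L h1 h2 h3
  exact h1.le.trans (uu_lower d hd L (k L) h3 h2)
end

section
/- Let d ≥ 1 and L ≥ 0 be integers. For multi-indices α = (α₁,…,α_d) and β = (β₁,…,β_d) of non-negative integers with α₁+⋯+α_d ≤ L and β₁+⋯+β_d ≤ L, one has ∫_{ℂ^d} z^α · conj(z)^β · (1 + ‖z‖²)^{−(d+L+1)} dz = δ_{αβ} · π^d · α₁!⋯α_d! · (L − (α₁+⋯+α_d))! / (d+L)!, where the integral is with respect to Lebesgue measure on ℂ^d ≅ ℝ^{2d} and z^α = z₁^{α₁}⋯z_d^{α_d}. Equivalently, the functions √(C^L_{α₁,…,α_d}) · z^α / (1+‖z‖²)^{(d+L+1)/2} with C^L_{α₁,…,α_d} = (1/π^d)·(d+L)!/(α₁!⋯α_d!·(L−(α₁+⋯+α_d))!) form an orthonormal family in L²(ℂ^d, ℂ). -/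
open MeasureTheory

noncomputable instance (n : ℕ) : MeasurableSpace (EuclideanSpace ℂ (Fin n)) := borel _
instance (n : ℕ) : BorelSpace (EuclideanSpace ℂ (Fin n)) := ⟨rfl⟩
noncomputable instance (n : ℕ) : InnerProductSpace ℝ (EuclideanSpace ℂ (Fin n)) :=
  InnerProductSpace.rclikeToReal ℂ _


lemma gauss_norm (t : ℝ) (ht : 0 < t) (q : ℕ) :
    ∫ z : ℂ, ‖z‖ ^ q * Real.exp (-t * ‖z‖ ^ 2)
      = Real.pi * Real.Gamma (q / 2 + 1) * t ^ (-((q : ℝ) / 2 + 1)) := by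
  have h := Complex.integral_rpow_mul_exp_neg_mul_rpow (p := 2) (q := q) (b := t) (by norm_num)
    (by have : (0:ℝ) ≤ q := q.cast_nonneg
        linarith) ht
  have e1 : ((q : ℝ) + 2) / 2 = q / 2 + 1 := by ring
  simp only [Real.rpow_natCast, Real.rpow_two] at h
  rw [h, neg_div, e1]
  ring

lemma gauss_norm_integrable (t : ℝ) (ht : 0 < t) (q : ℕ) :
    Integrable (fun z : ℂ => ‖z‖ ^ q * Real.exp (-t * ‖z‖ ^ 2)) := by
  by_contra h
  have := integral_undef h
  rw [gauss_norm t ht] at this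
  have h2 : 0 < Real.Gamma (q / 2 + 1) := Real.Gamma_pos_of_pos (by positivity)
  have : 0 < Real.pi * Real.Gamma (q / 2 + 1) * t ^ (-((q : ℝ) / 2 + 1)) := by positivity
  linarith

lemma norm_g (t : ℝ) (a b : ℕ) (z : ℂ) :
    ‖z ^ a * (starRingEnd ℂ) z ^ b * (Real.exp (-t * ‖z‖ ^ 2) : ℂ)‖
      = ‖z‖ ^ (a + b) * Real.exp (-t * ‖z‖ ^ 2) := by
  rw [norm_mul, norm_mul, norm_pow, norm_pow, Complex.norm_conj, pow_add, Complex.norm_real,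
    Real.norm_of_nonneg (Real.exp_pos _).le]

lemma gauss_integrable (t : ℝ) (ht : 0 < t) (a b : ℕ) :
    Integrable (fun z : ℂ => z ^ a * (starRingEnd ℂ) z ^ b * (Real.exp (-t * ‖z‖ ^ 2) : ℂ)) := by
  refine (gauss_norm_integrable t ht (a + b)).mono' ?_ (Filter.Eventually.of_forall fun z => ?_)
  · apply Continuous.aestronglyMeasurable
    have := Complex.continuous_conj
    fun_prop
  · rw [norm_g]

lemma gauss_integral (t : ℝ) (ht : 0 < t) (a b : ℕ) :
    ∫ z : ℂ, z ^ a * (starRingEnd ℂ) z ^ b * (Real.exp (-t * ‖z‖ ^ 2) : ℂ)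
      = if a = b then ((Real.pi * (a.factorial : ℝ) / t ^ (a + 1) : ℝ) : ℂ) else 0 := by
  split_ifs with h
  · subst h
    have h1 : ∀ z : ℂ, z ^ a * (starRingEnd ℂ) z ^ a * (Real.exp (-t * ‖z‖ ^ 2) : ℂ)
        = ((‖z‖ ^ (2 * a) * Real.exp (-t * ‖z‖ ^ 2) : ℝ) : ℂ) := by
      intro z
      rw [← mul_pow, Complex.mul_conj, Complex.normSq_eq_norm_sq]
      push_cast
      rw [pow_mul]
    simp_rw [h1]
    rw [integral_complex_ofReal, gauss_norm t ht]
    congr 1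
    have : ((2 * a : ℕ) : ℝ) / 2 + 1 = (a : ℝ) + 1 := by push_cast; ring
    rw [this, Real.Gamma_nat_eq_factorial, Real.rpow_neg ht.le, div_eq_mul_inv]
    norm_cast
  · set I := ∫ z : ℂ, z ^ a * (starRingEnd ℂ) z ^ b * (Real.exp (-t * ‖z‖ ^ 2) : ℂ) with hI
    have hab : ((a : ℝ) - b) ≠ 0 := sub_ne_zero.2 (by exact_mod_cast h)
    let u : Circle := Circle.exp (Real.pi / ((a : ℝ) - b))
    have hmp : MeasurePreserving (rotation u) := (rotation u).measurePreserving
    have h2 := hmp.integral_comp (rotation u).toHomeomorph.measurableEmbedding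
      (fun z : ℂ => z ^ a * (starRingEnd ℂ) z ^ b * (Real.exp (-t * ‖z‖ ^ 2) : ℂ))
    rw [← hI] at h2
    have h3 : ∀ z : ℂ, (rotation u z) ^ a * (starRingEnd ℂ) (rotation u z) ^ b
        * (Real.exp (-t * ‖rotation u z‖ ^ 2) : ℂ)
        = -1 * (z ^ a * (starRingEnd ℂ) z ^ b * (Real.exp (-t * ‖z‖ ^ 2) : ℂ)) := by
      intro z
      have hu : (u : ℂ) ^ a * (starRingEnd ℂ) (u : ℂ) ^ b = -1 := by
        rw [← Circle.coe_inv_eq_conj, ← Complex.exp_pi_mul_I]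
        simp only [u, ← Circle.exp_neg, Circle.coe_exp, ← Complex.exp_nat_mul, ← Complex.exp_add]
        congr 1
        have hab' : ((a : ℂ) - b) ≠ 0 := by exact_mod_cast hab
        push_cast
        field_simp
        ring
      rw [LinearIsometryEquiv.norm_map, rotation_apply, map_mul, mul_pow, mul_pow, ← hu]
      ring
    simp_rw [h3] at h2
    rw [integral_const_mul, ← hI] at h2
    have : (2 : ℂ) * I = 0 := by linear_combination -h2
    simpa using this

lemma map_vol (d : ℕ) : Measure.map (fun z : EuclideanSpace ℂ (Fin d) => (z : Fin d → ℂ)) volume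
    = (volume : Measure (Fin d → ℂ)) := by
  have hm : Measurable (fun z : EuclideanSpace ℂ (Fin d) => (z : Fin d → ℂ)) :=
    (PiLp.continuousLinearEquiv 2 ℂ (fun _ : Fin d => ℂ)).continuous.measurable
  have hh : (Measure.map (fun z : EuclideanSpace ℂ (Fin d) => (z : Fin d → ℂ)) volume).IsAddHaarMeasure :=
    AddEquiv.isAddHaarMeasure_map volume
     (PiLp.continuousLinearEquiv 2 ℂ (fun _ : Fin d => ℂ)).toLinearEquiv.toAddEquiv
     (PiLp.continuousLinearEquiv 2 ℂ (fun _ : Fin d => ℂ)).continuous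
     (PiLp.continuousLinearEquiv 2 ℂ (fun _ : Fin d => ℂ)).symm.continuous
  obtain ⟨c, h1⟩ : ∃ c : NNReal, Measure.map (fun z : EuclideanSpace ℂ (Fin d) => (z : Fin d → ℂ)) volume = c • (volume : Measure (Fin d → ℂ)) := ⟨_, Measure.isAddLeftInvariant_eq_smul _ _⟩
  have hE := GaussianFourier.integral_rexp_neg_mul_sq_norm (V := EuclideanSpace ℂ (Fin d)) one_pos
  have hP : ∫ z : Fin d → ℂ, ∏ i, Real.exp (-1 * ‖z i‖ ^ 2) = Real.pi ^ d := by
    rw [integral_fintype_prod_volume_eq_pow (fun z : ℂ => Real.exp (-1 * ‖z‖ ^ 2))]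
    have := gauss_norm 1 one_pos 0
    simp at this
    simp [this]
  have hf : Module.finrank ℝ (EuclideanSpace ℂ (Fin d)) = 2 * d := by
    have := finrank_real_of_complex (EuclideanSpace ℂ (Fin d))
    rw [finrank_euclideanSpace_fin] at this
    exact this
  have hM : ∫ z, ∏ i, Real.exp (-1 * ‖z i‖ ^ 2) ∂(Measure.map (fun z : EuclideanSpace ℂ (Fin d) => (z : Fin d → ℂ)) volume) = Real.pi ^ d := by
    rw [integral_map hm.aemeasurable (by apply Continuous.aestronglyMeasurable; fun_prop)]
    rw [hf] at hE
    simp_rw [← Real.exp_sum, ← Finset.mul_sum, ← EuclideanSpace.norm_sq_eq]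
    rw [hE]
    push_cast
    rw [mul_div_cancel_left₀ _ two_ne_zero, div_one, Real.rpow_natCast]
  rw [h1, integral_smul_nnreal_measure, hP] at hM
  have hc : c = 1 := by
    have hp : Real.pi ^ d ≠ 0 := by positivity
    have : (c : ℝ) * Real.pi ^ d = 1 * Real.pi ^ d := by rw [one_mul]; exact hM
    exact_mod_cast mul_right_cancel₀ hp this
  rw [h1, hc, one_smul]

noncomputable def bigF (d L : ℕ) (α β : Fin d → ℕ) (t : ℝ) (z : Fin d → ℂ) : ℂ :=
  ((t ^ (d + L) * Real.exp (-t) : ℝ) : ℂ) *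
    ∏ i, (z i ^ α i * (starRingEnd ℂ) (z i) ^ β i * (Real.exp (-t * ‖z i‖ ^ 2) : ℂ))

lemma gamma_nat (n : ℕ) (r : ℝ) (hr : 0 < r) :
    ∫ t in Set.Ioi (0:ℝ), t ^ n * Real.exp (-(r * t)) = n.factorial / r ^ (n + 1) := by
  have := Real.integral_rpow_mul_exp_neg_mul_Ioi (a := n + 1) (r := r) (by positivity) hr
  rw [add_sub_cancel_right, Real.Gamma_nat_eq_factorial] at this
  simp only [Real.rpow_natCast] at this
  rw [this]
  have : ((n : ℝ) + 1) = ((n + 1 : ℕ) : ℝ) := by push_cast; ring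
  rw [this, Real.rpow_natCast, one_div, inv_pow]
  field_simp

lemma bigF_t (d L : ℕ) (α β : Fin d → ℕ) (z : Fin d → ℂ) :
    ∫ t in Set.Ioi (0:ℝ), bigF d L α β t z =
      ((d + L).factorial : ℂ) * ((∏ i, z i ^ α i) * (starRingEnd ℂ) (∏ i, z i ^ β i) *
          ((1 + ∑ i, ‖z i‖ ^ 2 : ℝ) : ℂ) ^ (-((d : ℤ) + L + 1))) := by
  have hS : 0 < 1 + ∑ i, ‖z i‖ ^ 2 := by positivity
  have h1 : ∀ t : ℝ, bigF d L α β t z = (∏ i, z i ^ α i) * (starRingEnd ℂ) (∏ i, z i ^ β i) *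
      ((t ^ (d + L) * Real.exp (-((1 + ∑ i, ‖z i‖ ^ 2) * t)) : ℝ) : ℂ) := by
    intro t
    have : Real.exp (-((1 + ∑ i, ‖z i‖ ^ 2) * t))
        = Real.exp (-t) * ∏ i, Real.exp (-t * ‖z i‖ ^ 2) := by
      rw [← Real.exp_sum, ← Real.exp_add, ← Finset.mul_sum]
      congr 1; ring
    rw [this, bigF, Finset.prod_mul_distrib, Finset.prod_mul_distrib, map_prod]
    simp only [map_pow, Complex.ofReal_mul, Complex.ofReal_prod]
    ring
  simp_rw [h1]
  rw [integral_const_mul, integral_complex_ofReal, gamma_nat _ _ hS, zpow_neg]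
  have : ((d : ℤ) + L + 1) = ((d + L + 1 : ℕ) : ℤ) := by push_cast; ring
  rw [this, zpow_natCast]
  push_cast
  ring

lemma bigF_z (d L : ℕ) (α β : Fin d → ℕ) (hα : ∑ i, α i ≤ L) (t : ℝ) (ht : 0 < t) :
    ∫ z, bigF d L α β t z =
      (if α = β then ((Real.pi ^ d * (∏ i, ((α i).factorial : ℝ)) : ℝ) : ℂ) else 0) *
        ((t ^ (L - ∑ i, α i) * Real.exp (-(1 * t)) : ℝ) : ℂ) := by
  unfold bigF
  rw [integral_const_mul, integral_fintype_prod_volume_eq_prod (fun i (z : ℂ) =>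
    z ^ α i * (starRingEnd ℂ) z ^ β i * (Real.exp (-t * ‖z‖ ^ 2) : ℂ))]
  simp_rw [gauss_integral t ht]
  split_ifs with h
  · subst h
    simp only [if_true]
    rw [← Complex.ofReal_prod, ← Complex.ofReal_mul, ← Complex.ofReal_mul]
    congr 1
    rw [Finset.prod_div_distrib, Finset.prod_mul_distrib, Finset.prod_const,
      Finset.prod_pow_eq_pow_sum, Finset.sum_add_distrib]
    simp only [Finset.card_univ, Fintype.card_fin, Finset.sum_const, smul_eq_mul, mul_one]
    have : t ^ (d + L) = t ^ (L - ∑ i, α i) * t ^ (∑ i, α i + d) := by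
      rw [← pow_add]; congr 1; omega
    rw [this, one_mul]
    field_simp
  · obtain ⟨i, hi⟩ := Function.ne_iff.1 h
    rw [Finset.prod_eq_zero (Finset.mem_univ i) (by simp [hi])]
    simp

lemma bigF_integrable (d L : ℕ) (α β : Fin d → ℕ) (hα : ∑ i, α i ≤ L) (hβ : ∑ i, β i ≤ L) :
    Integrable (Function.uncurry (bigF d L α β))
      ((volume.restrict (Set.Ioi (0:ℝ))).prod (volume : Measure (Fin d → ℂ))) := by
  have hc : Continuous (Function.uncurry (bigF d L α β)) := by
    unfold bigF Function.uncurry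
    have := Complex.continuous_conj
    fun_prop
  rw [integrable_prod_iff hc.aestronglyMeasurable]
  constructor
  · filter_upwards [ae_restrict_mem measurableSet_Ioi] with t ht
    exact (Integrable.fintype_prod (f := fun i (z : ℂ) =>
      z ^ α i * (starRingEnd ℂ) z ^ β i * (Real.exp (-t * ‖z‖ ^ 2) : ℂ))
      fun i => gauss_integrable t ht _ _).const_mul
      ((t ^ (d + L) * Real.exp (-t) : ℝ) : ℂ)
  · set s : ℝ := L - (∑ i, ((α i + β i : ℕ) : ℝ)) / 2 + 1 with hs
    have hs0 : 0 < s := by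
      have h1 : (∑ i, (α i : ℝ)) ≤ L := by exact_mod_cast hα
      have h2 : (∑ i, (β i : ℝ)) ≤ L := by exact_mod_cast hβ
      simp only [hs, Nat.cast_add, Finset.sum_add_distrib]
      linarith
    have hint := (Real.GammaIntegral_convergent hs0).const_mul
      (∏ i, (Real.pi * Real.Gamma ((α i + β i : ℕ) / 2 + 1)))
    refine Integrable.congr hint ?_
    filter_upwards [ae_restrict_mem measurableSet_Ioi] with t ht
    have ht : 0 < t := ht
    simp only [Function.uncurry, bigF, norm_mul, norm_prod]
    have e : ∀ z : Fin d → ℂ, ∏ i, (‖z i ^ α i‖ * ‖(starRingEnd ℂ) (z i) ^ β i‖ *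
        ‖(Real.exp (-t * ‖z i‖ ^ 2) : ℂ)‖) =
        ∏ i, (‖z i‖ ^ (α i + β i) * Real.exp (-t * ‖z i‖ ^ 2)) := by
      intro z
      refine Finset.prod_congr rfl fun i _ => ?_
      rw [← norm_g, norm_mul, norm_mul]
    simp_rw [e]
    rw [integral_const_mul, integral_fintype_prod_volume_eq_prod (fun i (z : ℂ) =>
      ‖z‖ ^ (α i + β i) * Real.exp (-t * ‖z‖ ^ 2))]
    simp_rw [gauss_norm t ht]
    rw [Complex.norm_real, Real.norm_of_nonneg (by positivity),
      Finset.prod_mul_distrib (f := fun i => Real.pi * Real.Gamma (((α i + β i : ℕ) : ℝ) / 2 + 1)),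
      ← Real.rpow_sum_of_pos ht]
    have : t ^ (s - 1) = t ^ (d + L) * t ^ (∑ i, -(((α i + β i : ℕ) : ℝ) / 2 + 1)) := by
      rw [← Real.rpow_natCast, ← Real.rpow_add ht]
      congr 1
      simp only [Finset.sum_neg_distrib, Finset.sum_add_distrib, ← Finset.sum_div, hs]
      simp
      ring
    rw [this]
    ring

theorem stmt8 (d L : ℕ) (hd : 1 ≤ d) (α β : Fin d → ℕ)
    (hα : ∑ i, α i ≤ L) (hβ : ∑ i, β i ≤ L) :
    (∫ z : EuclideanSpace ℂ (Fin d),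
        (∏ i, z i ^ α i) * (starRingEnd ℂ) (∏ i, z i ^ β i) *
          ((1 + ‖z‖ ^ 2 : ℝ) : ℂ) ^ (-((d : ℤ) + L + 1)))
      = if α = β then
          ((Real.pi ^ d * (∏ i, ((α i).factorial : ℝ)) * ((L - ∑ i, α i).factorial : ℝ) /
            ((d + L).factorial : ℝ) : ℝ) : ℂ)
        else 0 := by
  have hemb : MeasurableEmbedding (fun z : EuclideanSpace ℂ (Fin d) => (z : Fin d → ℂ)) :=
    (PiLp.continuousLinearEquiv 2 ℂ (fun _ : Fin d => ℂ)).toHomeomorph.measurableEmbedding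
  have h1 := hemb.integral_map (μ := volume) (fun z : Fin d → ℂ =>
    (∏ i, z i ^ α i) * (starRingEnd ℂ) (∏ i, z i ^ β i) *
          ((1 + ∑ i, ‖z i‖ ^ 2 : ℝ) : ℂ) ^ (-((d : ℤ) + L + 1)))
  rw [map_vol] at h1
  simp_rw [EuclideanSpace.norm_sq_eq]
  rw [← h1]
  have h2 := integral_integral_swap (bigF_integrable d L α β hα hβ)
  simp_rw [bigF_t] at h2
  rw [integral_const_mul, setIntegral_congr_fun measurableSet_Ioi
    (fun t ht => bigF_z d L α β hα t ht), integral_const_mul, integral_complex_ofReal,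
    gamma_nat _ _ one_pos] at h2
  have hf : ((d + L).factorial : ℂ) ≠ 0 := by exact_mod_cast (d + L).factorial_ne_zero
  rw [← mul_right_inj' hf, ← h2]
  split_ifs
  · push_cast
    rw [one_pow, div_one]
    field_simp
  · simp
end
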